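/- There exists a constant C > 0 such that the following holds. For every directed graph G on a finite vertex set V with arc set E ⊆ V × V, every pair of distinct vertices s, t ∈ V, and every natural number k, there is a finitely supported probability distribution D on subsets A of V × V such that for every star st-cut Z of G with |Z| ≤ k, with probability at least 2^(−C·(k+2)^4·log(k+2)) under D (log denoting the natural logarithm) the following three conditions hold simultaneously: A is compatible with Z; core_{G+A}(Z) is a minimum st-cut of G+A; and there exists a witnessing flow for Z in G+A. -/

import Mathlib

open scoped Classical

namespace FlowAug

variable {V : Type}

/-- Reachability from `a` to `b` using arcs in `A`. -/
def Reach (A : Set (V × V)) (a b : V) : Prop :=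
  Relation.ReflTransGen (fun u v => (u, v) ∈ A) a b

/-- `Z` is an `st`-cut of the directed graph with arc set `E`. -/
def IsCut (E : Finset (V × V)) (s t : V) (Z : Finset (V × V)) : Prop :=
  Z ⊆ E ∧ ¬ Reach ((E : Set (V × V)) \ (Z : Set (V × V))) s t

/-- A minimal `st`-cut: no proper subset is an `st`-cut. -/
def IsMinimalCut (E : Finset (V × V)) (s t : V) (Z : Finset (V × V)) : Prop :=
  IsCut E s t Z ∧ ∀ Z', Z' ⊂ Z → ¬ IsCut E s t Z'

/-- A minimum `st`-cut: of minimum cardinality among all `st`-cuts. -/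
def IsMinCut (E : Finset (V × V)) (s t : V) (Z : Finset (V × V)) : Prop :=
  IsCut E s t Z ∧ ∀ Z', IsCut E s t Z' → Z.card ≤ Z'.card

/-- `Z ⊆ E` is an `st`-cut of the augmented graph `G + A`. -/
def IsCutAug (E A : Finset (V × V)) (s t : V) (Z : Finset (V × V)) : Prop :=
  Z ⊆ E ∧ ¬ Reach (((E : Set (V × V)) \ (Z : Set (V × V))) ∪ (A : Set (V × V))) s t

/-- A minimum `st`-cut of the augmented graph `G + A`. -/
def IsMinCutAug (E A : Finset (V × V)) (s t : V) (Z : Finset (V × V)) : Prop :=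
  IsCutAug E A s t Z ∧ ∀ Z', IsCutAug E A s t Z' → Z.card ≤ Z'.card

/-- The `s`-side of the cut `Z`: vertices reachable from `s` using arcs of `E \ Z`. -/
def sSide (E : Finset (V × V)) (s : V) (Z : Finset (V × V)) : Set V :=
  {v | Reach ((E : Set (V × V)) \ (Z : Set (V × V))) s v}

/-- A star `st`-cut: every arc of `Z` has tail in the `s`-side and head in the `t`-side. -/
def IsStarCut (E : Finset (V × V)) (s t : V) (Z : Finset (V × V)) : Prop :=
  IsCut E s t Z ∧ ∀ e ∈ Z, e.1 ∈ sSide E s Z ∧ e.2 ∉ sSide E s Z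

/-- `A` is compatible with the star `st`-cut `Z`: no arc of `A` goes from the
`s`-side of `Z` to the `t`-side of `Z`. -/
def Compatible (E : Finset (V × V)) (s : V) (Z A : Finset (V × V)) : Prop :=
  ∀ e ∈ A, e.1 ∈ sSide E s Z → e.2 ∈ sSide E s Z

/-- `core_{G+A}(Z)`: arcs of `Z` whose head reaches `t` via arcs of `(E \ Z) ∪ A`. -/
noncomputable def coreAug (E A Z : Finset (V × V)) (t : V) : Finset (V × V) :=
  Z.filter (fun e =>
    Reach (((E : Set (V × V)) \ (Z : Set (V × V))) ∪ (A : Set (V × V))) e.2 t)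

/-- `core(Z)`: arcs of `Z` whose head reaches `t` via arcs of `E \ Z`. -/
noncomputable def core (E Z : Finset (V × V)) (t : V) : Finset (V × V) :=
  Z.filter (fun e => Reach ((E : Set (V × V)) \ (Z : Set (V × V))) e.2 t)

/-- `δ⁺(X)`: arcs of `E` with tail in `X` and head outside `X`. -/
noncomputable def deltaPlus (E : Finset (V × V)) (X : Set V) : Finset (V × V) :=
  E.filter (fun e => e.1 ∈ X ∧ e.2 ∉ X)

/-- The arcs traversed by a walk given by its list of vertices. -/
def arcsOf (p : List V) : List (V × V) := p.zip p.tail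

/-- `p` is a directed path from `s` to `t` using arcs of `A`. -/
def IsPathIn (A : Set (V × V)) (s t : V) (p : List V) : Prop :=
  p.Chain' (fun u v => (u, v) ∈ A) ∧ p.head? = some s ∧ p.getLast? = some t

/-- The paths `P i` are pairwise arc-disjoint. -/
def ArcDisjoint {lam : ℕ} (P : Fin lam → List V) : Prop :=
  ∀ i j, i ≠ j → ∀ e : V × V, ¬ (e ∈ arcsOf (P i) ∧ e ∈ arcsOf (P j))

/-- An `st`-flow: a family of pairwise arc-disjoint directed `st`-paths in `G`. -/
def IsFlow (E : Finset (V × V)) (s t : V) {lam : ℕ} (P : Fin lam → List V) : Prop :=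
  (∀ i, IsPathIn (E : Set (V × V)) s t (P i)) ∧ ArcDisjoint P

/-- A maximum `st`-flow: the number of paths equals the minimum cardinality of an `st`-cut. -/
def IsMaxFlow (E : Finset (V × V)) (s t : V) {lam : ℕ} (P : Fin lam → List V) : Prop :=
  IsFlow E s t P ∧ ∃ Z, IsMinCut E s t Z ∧ Z.card = lam

/-- Arcs of the residual graph `G^P`. -/
def ResArc (E : Finset (V × V)) {lam : ℕ} (P : Fin lam → List V) (u v : V) : Prop :=
  ((u, v) ∈ E ∧ ∀ i, (u, v) ∉ arcsOf (P i)) ∨ (∃ i, (v, u) ∈ arcsOf (P i))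

/-- Reachability in the residual graph `G^P`. -/
def ResReach (E : Finset (V × V)) {lam : ℕ} (P : Fin lam → List V) : V → V → Prop :=
  Relation.ReflTransGen (ResArc E P)

/-- `G` has proper boundaries: `δ⁺({s})` and `δ⁻({t})` are minimum `st`-cuts
and there is no arc `(s, t)`. -/
def ProperBoundaries [DecidableEq V] (E : Finset (V × V)) (s t : V) : Prop :=
  IsMinCut E s t (E.filter (fun e => e.1 = s)) ∧
  IsMinCut E s t (E.filter (fun e => e.2 = t)) ∧ (s, t) ∉ E

/-- The reachability pattern of `(G, P)` has only self-loops: no residual path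
between internal vertices of distinct flow paths. -/
def OnlySelfLoops (E : Finset (V × V)) (s t : V) {lam : ℕ} (P : Fin lam → List V) : Prop :=
  ∀ i j : Fin lam, i ≠ j → ∀ u ∈ P i, u ≠ s → u ≠ t → ∀ v ∈ P j, v ≠ s → v ≠ t →
    ¬ ResReach E P u v

/-- A bottleneck arc: an arc contained in some minimum `st`-cut. -/
def Bottleneck (E : Finset (V × V)) (s t : V) (e : V × V) : Prop :=
  ∃ Z, IsMinCut E s t Z ∧ e ∈ Z

/-- A witnessing flow for the star `st`-cut `Z` in `G + A`: `|core_{G+A}(Z)|`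
`st`-paths in `G + A`, pairwise sharing no arc of `E \ A`, each containing
exactly one arc of `core_{G+A}(Z)` and no arc of `Z \ core_{G+A}(Z)`. -/
def WitnessingFlow (E A Z : Finset (V × V)) (s t : V) : Prop :=
  ∃ P : Fin (coreAug E A Z t).card → List V,
    (∀ i, IsPathIn ((E : Set (V × V)) ∪ (A : Set (V × V))) s t (P i)) ∧
    (∀ i j, i ≠ j → ∀ e : V × V, e ∈ arcsOf (P i) → e ∈ arcsOf (P j) →
      e ∉ ((E : Set (V × V)) \ (A : Set (V × V)))) ∧
    (∀ i, ∃! e : V × V, e ∈ coreAug E A Z t ∧ e ∈ arcsOf (P i)) ∧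
    (∀ i, ∀ e ∈ arcsOf (P i), e ∈ Z → e ∈ coreAug E A Z t)

/-- Averaging over a uniformly random subset of `I`. -/
theorem exists_subset_separating {ι : Type*} (T : Finset ι) (μ : ι → ℝ) (hμ : ∀ i, 0 ≤ μ i)
    (I : Finset ℕ) (a : ι → ℕ) (B : ι → Finset ℕ) (m : ℕ)
    (haI : ∀ i ∈ T, a i ∈ I) (haB : ∀ i ∈ T, a i ∉ B i) (hB : ∀ i ∈ T, (B i).card ≤ m) :
    ∃ X ⊆ I, (1 / 2 : ℝ) ^ (m + 1) * ∑ i ∈ T, μ i ≤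
      ∑ i ∈ T with a i ∈ X ∧ Disjoint X (B i), μ i := by
  have hcount : ∀ i ∈ T, (1 / 2 : ℝ) ^ (m + 1) * (2 : ℝ) ^ I.card ≤
      ((I.powerset.filter fun X => a i ∈ X ∧ Disjoint X (B i)).card : ℝ) := by
    intro i hi
    have hsub : ((I \ insert (a i) (B i)).powerset.image (insert (a i))) ⊆
        I.powerset.filter fun X => a i ∈ X ∧ Disjoint X (B i) := by
      intro X hX
      obtain ⟨Y, hY, rfl⟩ := Finset.mem_image.1 hX
      rw [Finset.mem_powerset] at hY
      have h1 := haI i hi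
      have h2 := haB i hi
      simp only [Finset.mem_filter, Finset.mem_powerset, Finset.mem_insert, true_or, true_and,
        Finset.disjoint_insert_left]
      refine ⟨?_, h2, ?_⟩
      · intro x hx
        rcases Finset.mem_insert.1 hx with rfl | hx
        · exact h1
        · exact (Finset.mem_sdiff.1 (hY hx)).1
      · rw [Finset.disjoint_left]
        intro x hx hxB
        exact (Finset.mem_sdiff.1 (hY hx)).2 (Finset.mem_insert_of_mem hxB)
    have hinj : Set.InjOn (insert (a i) : Finset ℕ → Finset ℕ)
        (I \ insert (a i) (B i)).powerset := by
      intro X hX Y hY hXY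
      have key : ∀ W : Finset ℕ, W ∈ (I \ insert (a i) (B i)).powerset → a i ∉ W := by
        intro W hW haW
        exact (Finset.mem_sdiff.1 (Finset.mem_powerset.1 hW haW)).2 (Finset.mem_insert_self _ _)
      have := congrArg (fun W => W.erase (a i)) hXY
      simpa [Finset.erase_insert (key X hX), Finset.erase_insert (key Y hY)] using this
    have hcard := Finset.card_le_card hsub
    rw [Finset.card_image_of_injOn hinj, Finset.card_powerset] at hcard
    have h3 : I.card ≤ (I \ insert (a i) (B i)).card + (m + 1) := by
      have h4 := Finset.card_le_card_sdiff_add_card (s := I) (t := insert (a i) (B i))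
      have h5 := Finset.card_insert_le (a i) (B i)
      have h6 := hB i hi
      omega
    have h7 : (2 : ℝ) ^ I.card ≤ 2 ^ ((I \ insert (a i) (B i)).card) * 2 ^ (m + 1) := by
      rw [← pow_add]
      exact pow_le_pow_right₀ (by norm_num) h3
    calc (1 / 2 : ℝ) ^ (m + 1) * (2 : ℝ) ^ I.card
        ≤ (1 / 2 : ℝ) ^ (m + 1) * (2 ^ ((I \ insert (a i) (B i)).card) * 2 ^ (m + 1)) := by
          gcongr
      _ = ((1 / 2 : ℝ) * 2) ^ (m + 1) * 2 ^ ((I \ insert (a i) (B i)).card) := by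
          rw [mul_pow]; ring
      _ = 2 ^ ((I \ insert (a i) (B i)).card) := by norm_num
      _ ≤ _ := by exact_mod_cast hcard
  have hsum : ∑ X ∈ I.powerset, ((1 / 2 : ℝ) ^ (m + 1) * ∑ i ∈ T, μ i) ≤
      ∑ X ∈ I.powerset, ∑ i ∈ T with a i ∈ X ∧ Disjoint X (B i), μ i := by
    simp_rw [Finset.sum_filter]
    rw [Finset.sum_comm, Finset.sum_const, Finset.card_powerset, nsmul_eq_mul, Finset.mul_sum,
      Finset.mul_sum]
    refine Finset.sum_le_sum fun i hi => ?_
    rw [← Finset.sum_filter, Finset.sum_const, nsmul_eq_mul]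
    have := mul_le_mul_of_nonneg_right (hcount i hi) (hμ i)
    push_cast
    linarith
  obtain ⟨X, hX, h⟩ := Finset.exists_le_of_sum_le ⟨∅, Finset.empty_mem_powerset I⟩ hsum
  exact ⟨X, Finset.mem_powerset.1 hX, h⟩

/-- The index and the first element of the cell containing a natural number, for the greedy
partition of `[lo, ∞)` in which a new cell starts as soon as all functions `U c` with `c ∈ act`
have strictly increased since the start of the current cell. -/
noncomputable def cell {C : Type*} (U : C → ℕ → ℕ) (act : Finset C) (lo : ℕ) : ℕ → ℕ × ℕ
  | 0 => (0, lo)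
  | h + 1 =>
    if lo ≤ h ∧ ∀ c ∈ act, U c (cell U act lo h).2 < U c (h + 1) then
      ((cell U act lo h).1 + 1, h + 1)
    else cell U act lo h

section cell

variable {C : Type*} {U : C → ℕ → ℕ} {act : Finset C} {lo : ℕ}

theorem cell_fst_mono : Monotone fun h => (cell U act lo h).1 := by
  refine monotone_nat_of_le_succ fun h => ?_
  simp only [cell]
  split_ifs <;> simp

theorem cell_snd_le {h : ℕ} (hh : lo ≤ h) : (cell U act lo h).2 ≤ h := by
  induction h with
  | zero => simpa [cell] using hh
  | succ h ih =>
    simp only [cell]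
    split_ifs with hc
    · simp
    · rcases Nat.lt_or_ge h lo with h1 | h1
      · have : cell U act lo h = (0, lo) := by
          clear ih hc hh
          induction h with
          | zero => rfl
          | succ h ih =>
            simp only [cell]
            rw [if_neg (by omega), ih (by omega)]
        rw [this]; exact hh
      · exact (ih h1).trans (Nat.le_succ h)

theorem le_cell_snd (h : ℕ) : lo ≤ (cell U act lo h).2 := by
  induction h with
  | zero => simp [cell]
  | succ h ih =>
    simp only [cell]
    split_ifs with hc
    · exact hc.1.trans (Nat.le_succ h)
    · exact ih

theorem cell_eq_of_fst_eq {h g : ℕ} (hfst : (cell U act lo h).1 = (cell U act lo g).1) :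
    cell U act lo h = cell U act lo g := by
  wlog hhg : h ≤ g generalizing h g
  · exact (this hfst.symm (le_of_not_ge hhg)).symm
  induction g, hhg using Nat.le_induction with
  | base => rfl
  | succ g hg ih =>
    have hmono := cell_fst_mono (U := U) (act := act) (lo := lo) hg
    simp only [cell] at hfst ⊢
    split_ifs at hfst ⊢ with hc
    · simp only at hfst hmono; omega
    · exact ih hfst

theorem cell_cell_snd {h : ℕ} (hh : lo ≤ h) :
    (cell U act lo (cell U act lo h).2).1 = (cell U act lo h).1 := by
  have hlo : cell U act lo lo = (0, lo) := by
    suffices ∀ h ≤ lo, cell U act lo h = (0, lo) from this lo le_rfl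
    intro h
    induction h with
    | zero => intro _; rfl
    | succ h ih =>
      intro hle
      simp only [cell]
      rw [if_neg (by omega), ih (by omega)]
  induction h, hh using Nat.le_induction with
  | base => simp [hlo]
  | succ h _ ih =>
    by_cases hc : lo ≤ h ∧ ∀ c ∈ act, U c (cell U act lo h).2 < U c (h + 1)
    · have : cell U act lo (h + 1) = ((cell U act lo h).1 + 1, h + 1) := by
        simp only [cell]; rw [if_pos hc]
      rw [this]; simp [this]
    · have : cell U act lo (h + 1) = cell U act lo h := by
        simp only [cell]; rw [if_neg hc]
      rw [this]; exact ih

theorem lt_of_cell_add_two_le (hU : ∀ c, Monotone (U c)) {h g : ℕ}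
    (hle : (cell U act lo h).1 + 2 ≤ (cell U act lo g).1) : ∀ c ∈ act, U c h < U c g := by
  induction g with
  | zero => simp [cell] at hle
  | succ g ih =>
    intro c hc
    by_cases hg : (cell U act lo h).1 + 2 ≤ (cell U act lo g).1
    · exact (ih hg c hc).trans_le (hU c (Nat.le_succ g))
    · by_cases hcond : lo ≤ g ∧ ∀ c ∈ act, U c (cell U act lo g).2 < U c (g + 1)
      · have h1 : (cell U act lo (g + 1)).1 = (cell U act lo g).1 + 1 := by
          simp only [cell]; rw [if_pos hcond]
        have h2 : h < (cell U act lo g).2 := by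
          by_contra hcon
          have := cell_fst_mono (U := U) (act := act) (lo := lo) (not_lt.1 hcon)
          simp only [cell_cell_snd hcond.1] at this
          omega
        exact (hU c h2.le).trans_lt (hcond.2 c hc)
      · have h1 : cell U act lo (g + 1) = cell U act lo g := by
          simp only [cell]; rw [if_neg hcond]
        rw [h1] at hle
        exact absurd hle hg

theorem exists_not_lt_of_cell_snd_lt {h : ℕ} (hh : lo ≤ h) (hlt : (cell U act lo h).2 < h) :
    ∃ c ∈ act, ¬ U c (cell U act lo h).2 < U c h := by
  cases h with
  | zero => simp at hlt
  | succ h =>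
    by_cases hcond : lo ≤ h ∧ ∀ c ∈ act, U c (cell U act lo h).2 < U c (h + 1)
    · simp only [cell] at hlt; rw [if_pos hcond] at hlt; simp at hlt
    · have h1 : cell U act lo (h + 1) = cell U act lo h := by
        simp only [cell]; rw [if_neg hcond]
      rw [h1] at hlt ⊢
      have hlo : lo ≤ h := by
        have := le_cell_snd (U := U) (act := act) (lo := lo) h
        omega
      by_contra hcon
      push Not at hcon
      exact hcond ⟨hlo, hcon⟩

end cell

/-- Sampling a set of positions that contains `w i` and avoids the bad positions of `i`. -/
theorem exists_hitting_avoiding {ι C : Type*} [Fintype C] (U : C → ℕ → ℕ)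
    (hU : ∀ c, Monotone (U c)) (μ : ι → ℝ) (hμ : ∀ i, 0 ≤ μ i) (w : ι → ℕ)
    (Bad : ι → ℕ → Prop) (K : ι → Finset ℕ) (m n : ℕ) :
    ∀ (lo hi : ℕ) (T : Finset ι), (Finset.univ.filter fun c => U c lo < U c hi).card ≤ n →
      (∀ i ∈ T, lo ≤ w i ∧ w i ≤ hi) →
      (∀ i ∈ T, ∀ h, Bad i h → h < w i ∧ ∃ κ ∈ K i, ∃ c, h ≤ κ ∧
        (∀ g, U c h < U c g → κ < g) ∧ ∀ g, w i < g → U c h < U c g) →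
      (∀ i ∈ T, (K i).card ≤ m) →
      (∀ i ∈ T, ∃ c, ∀ h < w i, U c h < U c (w i)) →
      ∃ Q : Finset ℕ, (∀ q ∈ Q, lo ≤ q ∧ q ≤ hi) ∧
        (1 / 2 : ℝ) ^ ((2 * m + 2) * n) * ∑ i ∈ T, μ i ≤
          ∑ i ∈ T with w i ∈ Q ∧ ∀ q ∈ Q, ¬ Bad i q, μ i := by
  induction n with
  | zero =>
    intro lo hi T hrank hw hbad hK hL
    by_cases hlohi : lo ≤ hi
    · refine ⟨{lo}, by simp [hlohi], ?_⟩
      have : (T.filter fun i => w i ∈ ({lo} : Finset ℕ) ∧ ∀ q ∈ ({lo} : Finset ℕ), ¬ Bad i q) = T := by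
        refine Finset.filter_true_of_mem fun i hi' => ?_
        obtain ⟨c, hc⟩ := hL i hi'
        have hwi : w i = lo := by
          by_contra hne
          have h1 : lo < w i := lt_of_le_of_ne (hw i hi').1 (Ne.symm hne)
          have h2 := (hc lo h1).trans_le (hU c (hw i hi').2)
          have h3 : c ∈ Finset.univ.filter fun c => U c lo < U c hi := by simpa using h2
          have := Finset.card_pos.2 ⟨c, h3⟩
          omega
        refine ⟨by simp [hwi], ?_⟩
        intro q hq hb
        have := (hbad i hi' q hb).1
        rw [Finset.mem_singleton] at hq
        omega
      rw [this]; simp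
    · refine ⟨∅, by simp, ?_⟩
      have : T = ∅ := by
        refine Finset.eq_empty_of_forall_notMem fun i hi' => ?_
        have := hw i hi'
        omega
      simp [this]
  | succ n ih =>
    intro lo hi T hrank hw hbad hK hL
    have hTn : 0 ≤ ∑ i ∈ T, μ i := Finset.sum_nonneg fun i _ => hμ i
    by_cases hrn : (Finset.univ.filter fun c => U c lo < U c hi).card ≤ n
    · obtain ⟨Q, hQ, hQm⟩ := ih lo hi T hrn hw hbad hK hL
      refine ⟨Q, hQ, le_trans (mul_le_mul_of_nonneg_right ?_ hTn) hQm⟩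
      exact pow_le_pow_of_le_one (by norm_num) (by norm_num)
        (Nat.mul_le_mul_left _ (Nat.le_succ n))
    have hsplit := Finset.sum_filter_add_sum_filter_not T (fun i => w i = hi) μ
    by_cases hhalf : (1 / 2 : ℝ) * ∑ i ∈ T, μ i ≤ ∑ i ∈ T with w i = hi, μ i
    · by_cases hlohi : lo ≤ hi
      · refine ⟨{hi}, by simp [hlohi], ?_⟩
        calc (1 / 2 : ℝ) ^ ((2 * m + 2) * (n + 1)) * ∑ i ∈ T, μ i
            ≤ (1 / 2 : ℝ) ^ 1 * ∑ i ∈ T, μ i := by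
              refine mul_le_mul_of_nonneg_right ?_ hTn
              exact pow_le_pow_of_le_one (by norm_num) (by norm_num) (by nlinarith)
          _ ≤ ∑ i ∈ T with w i = hi, μ i := by simpa using hhalf
          _ ≤ _ := by
              refine Finset.sum_le_sum_of_subset_of_nonneg ?_ fun i _ _ => hμ i
              intro i hi'
              rw [Finset.mem_filter] at hi' ⊢
              refine ⟨hi'.1, by simp [hi'.2], ?_⟩
              intro q hq hb
              have := (hbad i hi'.1 q hb).1
              rw [Finset.mem_singleton] at hq
              omega
      · refine ⟨∅, by simp, ?_⟩
        have : T = ∅ := by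
          refine Finset.eq_empty_of_forall_notMem fun i hi' => ?_
          have := hw i hi'
          omega
        simp [this]
    set T' := T.filter fun i => ¬ w i = hi with hT'
    have hT'half : (1 / 2 : ℝ) * ∑ i ∈ T, μ i ≤ ∑ i ∈ T', μ i := by linarith
    have hT'T : ∀ i ∈ T', i ∈ T := fun i h => (Finset.mem_filter.1 h).1
    have hwlt : ∀ i ∈ T', w i < hi := fun i h =>
      lt_of_le_of_ne (hw i (hT'T i h)).2 (Finset.mem_filter.1 h).2
    set act := Finset.univ.filter fun c => U c lo < U c hi with hact
    have hane : act.Nonempty := Finset.card_pos.1 (by omega)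
    set idx : ℕ → ℕ := fun h => (cell U act lo h).1 with hidx
    set touched : ι → Finset ℕ := fun i =>
      (Finset.range (idx (w i))).filter fun a => ∃ h, lo ≤ h ∧ h ≤ hi ∧ idx h = a ∧ Bad i h
      with htouched
    have htcard : ∀ i ∈ T', (touched i).card ≤ 2 * m := by
      intro i hi'
      have hsub : touched i ⊆ (K i).image idx ∪ (K i).image fun κ => idx κ - 1 := by
        intro a ha
        simp only [htouched, Finset.mem_filter, Finset.mem_range] at ha
        obtain ⟨-, h, hlo, hhi, rfl, hb⟩ := ha
        obtain ⟨hw', κ, hκ, c, hhκ, hκg, hg⟩ := hbad i (hT'T i hi') h hb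
        have hc : c ∈ act := by
          have := (hU c hlo).trans_lt (hg hi (hwlt i hi'))
          simpa [hact] using this
        have h1 : idx h ≤ idx κ := cell_fst_mono hhκ
        have h2 : idx κ < idx h + 2 := by
          by_contra hcon
          have := hκg κ (lt_of_cell_add_two_le hU (not_lt.1 hcon) c hc)
          omega
        rw [Finset.mem_union, Finset.mem_image, Finset.mem_image]
        rcases Nat.lt_or_ge (idx h) (idx κ) with h3 | h3
        · exact Or.inr ⟨κ, hκ, by omega⟩
        · exact Or.inl ⟨κ, hκ, by omega⟩
      have h1 := Finset.card_le_card hsub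
      have h2 := Finset.card_union_le ((K i).image idx) ((K i).image fun κ => idx κ - 1)
      have h3 := Finset.card_image_le (s := K i) (f := idx)
      have h4 := Finset.card_image_le (s := K i) (f := fun κ => idx κ - 1)
      have h5 := hK i (hT'T i hi')
      omega
    obtain ⟨X, hXI, hX⟩ := exists_subset_separating T' μ hμ (Finset.range (idx hi + 1))
      (fun i => idx (w i)) touched (2 * m)
      (fun i hi' => by
        have : idx (w i) ≤ idx hi := cell_fst_mono (hwlt i hi').le
        simpa using Nat.lt_succ_of_le this)
      (fun i hi' => by simp [htouched]) htcard
    set T'' := T'.filter fun i => idx (w i) ∈ X ∧ Disjoint X (touched i) with hT''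
    have hT''T : ∀ i ∈ T'', i ∈ T := fun i h => hT'T i (Finset.mem_filter.1 h).1
    have hcellQ : ∀ a, ∃ Q : Finset ℕ, (∀ q ∈ Q, lo ≤ q ∧ q ≤ hi ∧ idx q = a) ∧
        (1 / 2 : ℝ) ^ ((2 * m + 2) * n) * ∑ i ∈ T'' with idx (w i) = a, μ i ≤
          ∑ i ∈ T'' with idx (w i) = a ∧ w i ∈ Q ∧ ∀ q ∈ Q, ¬ Bad i q, μ i := by
      intro a
      by_cases hne : (T''.filter fun i => idx (w i) = a).Nonempty
      · obtain ⟨i0, hi0⟩ := hne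
        rw [Finset.mem_filter] at hi0
        set P := (Finset.Icc lo hi).filter fun h => idx h = a with hP
        have hwP : ∀ i ∈ T'', idx (w i) = a → w i ∈ P := fun i h h' => by
          have := hw i (hT''T i h)
          simp [hP, this, h']
        have hPne : P.Nonempty := ⟨w i0, hwP i0 hi0.1 hi0.2⟩
        set hi' := P.max' hPne with hhi'
        have hi'P : hi' ∈ P := Finset.max'_mem P hPne
        have hi'lo : lo ≤ hi' ∧ hi' ≤ hi ∧ idx hi' = a := by
          simpa [hP, and_assoc] using hi'P
        set lo' := (cell U act lo hi').2 with hlo'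
        have hlolo' : lo ≤ lo' := le_cell_snd _
        have hlo_le : lo' ≤ hi' := cell_snd_le hi'lo.1
        have hidxlo' : idx lo' = a := (cell_cell_snd hi'lo.1).trans hi'lo.2.2
        have hlo'P : ∀ h ∈ P, lo' ≤ h := by
          intro h hh
          have hh' : lo ≤ h ∧ h ≤ hi ∧ idx h = a := by simpa [hP, and_assoc] using hh
          have : cell U act lo hi' = cell U act lo h :=
            cell_eq_of_fst_eq (hi'lo.2.2.trans hh'.2.2.symm)
          rw [hlo', this]
          exact cell_snd_le hh'.1
        have hrank' : (Finset.univ.filter fun c => U c lo' < U c hi').card ≤ n := by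
          have hsub : (Finset.univ.filter fun c => U c lo' < U c hi') ⊂ act := by
            rw [Finset.ssubset_iff_of_subset]
            · rcases hlo_le.lt_or_eq with hlt | heq
              · obtain ⟨c, hc, hnlt⟩ := exists_not_lt_of_cell_snd_lt hi'lo.1 hlt
                exact ⟨c, hc, by simpa [hlo'] using hnlt⟩
              · obtain ⟨c, hc⟩ := hane
                exact ⟨c, hc, by simp [heq]⟩
            · intro c hc
              simp only [hact, Finset.mem_filter, Finset.mem_univ, true_and] at hc ⊢
              exact (hU c hlolo').trans_lt (hc.trans_le (hU c hi'lo.2.1))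
          have := Finset.card_lt_card hsub
          omega
        obtain ⟨Q, hQ, hQm⟩ := ih lo' hi' (T''.filter fun i => idx (w i) = a) hrank'
          (fun i h => by
            have := hwP i (Finset.mem_filter.1 h).1 (Finset.mem_filter.1 h).2
            exact ⟨hlo'P _ this, Finset.le_max' P _ this⟩)
          (fun i h => hbad i (hT''T i (Finset.mem_filter.1 h).1))
          (fun i h => hK i (hT''T i (Finset.mem_filter.1 h).1))
          (fun i h => hL i (hT''T i (Finset.mem_filter.1 h).1))
        refine ⟨Q, fun q hq => ?_, ?_⟩
        · have := hQ q hq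
          refine ⟨hlolo'.trans this.1, this.2.trans hi'lo.2.1, le_antisymm ?_ ?_⟩
          · exact (cell_fst_mono this.2).trans hi'lo.2.2.le
          · exact hidxlo'.symm.le.trans (cell_fst_mono this.1)
        · refine hQm.trans_eq (Finset.sum_congr ?_ fun _ _ => rfl)
          ext i
          simp only [Finset.mem_filter, and_assoc]
      · rw [Finset.not_nonempty_iff_eq_empty] at hne
        refine ⟨∅, by simp, ?_⟩
        rw [hne]
        simp only [Finset.sum_empty, mul_zero]
        exact Finset.sum_nonneg fun i _ => hμ i
    choose Q hQ hQm using hcellQ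
    refine ⟨X.biUnion Q, ?_, ?_⟩
    · intro q hq
      obtain ⟨a, -, hqa⟩ := Finset.mem_biUnion.1 hq
      exact ⟨(hQ a q hqa).1, (hQ a q hqa).2.1⟩
    have hfib1 : ∑ i ∈ T'', μ i = ∑ a ∈ X, ∑ i ∈ T'' with idx (w i) = a, μ i :=
      (Finset.sum_fiberwise_of_maps_to (fun i h => (Finset.mem_filter.1 h).2.1) _).symm
    have hfib2 : ∑ a ∈ X, ∑ i ∈ T'' with idx (w i) = a ∧ w i ∈ Q a ∧ ∀ q ∈ Q a, ¬ Bad i q, μ i ≤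
        ∑ i ∈ T with w i ∈ X.biUnion Q ∧ ∀ q ∈ X.biUnion Q, ¬ Bad i q, μ i := by
      have heq : ∀ a ∈ X, (T''.filter fun i => idx (w i) = a ∧ w i ∈ Q a ∧ ∀ q ∈ Q a, ¬ Bad i q) =
          (T''.filter fun i => w i ∈ X.biUnion Q ∧ ∀ q ∈ X.biUnion Q, ¬ Bad i q).filter
            fun i => idx (w i) = a := by
        intro a ha
        ext i
        simp only [Finset.mem_filter, Finset.mem_biUnion]
        constructor
        · rintro ⟨hiT, hia, hiQ, hib⟩
          refine ⟨⟨hiT, ⟨a, ha, hiQ⟩, ?_⟩, hia⟩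
          rintro q ⟨b, hbX, hqb⟩ hbq
          have hq := hQ b q hqb
          have hlt := (hbad i (hT''T i hiT) q hbq).1
          have hle : idx q ≤ idx (w i) := cell_fst_mono hlt.le
          rcases hle.lt_or_eq with h1 | h1
          · have hmem : idx q ∈ touched i := by
              simp only [htouched, Finset.mem_filter, Finset.mem_range]
              exact ⟨h1, q, hq.1, hq.2.1, rfl, hbq⟩
            rw [hq.2.2] at hmem
            exact (Finset.disjoint_left.1 (Finset.mem_filter.1 hiT).2.2 hbX) hmem
          · rw [hq.2.2, hia] at h1
            subst h1
            exact hib q hqb hbq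
        · rintro ⟨⟨hiT, ⟨b, hbX, hwb⟩, hib⟩, hia⟩
          have hba : b = a := (hQ b _ hwb).2.2.symm.trans hia
          subst hba
          exact ⟨hiT, hia, hwb, fun q hq => hib q ⟨b, ha, hq⟩⟩
      rw [Finset.sum_congr rfl fun a ha => by rw [heq a ha]]
      rw [Finset.sum_fiberwise_of_maps_to]
      · refine Finset.sum_le_sum_of_subset_of_nonneg ?_ fun i _ _ => hμ i
        intro i h
        rw [Finset.mem_filter] at h ⊢
        exact ⟨hT''T i h.1, h.2⟩
      · intro i h
        exact (Finset.mem_filter.1 (Finset.mem_filter.1 h).1).2.1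
    calc (1 / 2 : ℝ) ^ ((2 * m + 2) * (n + 1)) * ∑ i ∈ T, μ i
        = (1 / 2 : ℝ) ^ ((2 * m + 2) * n) * ((1 / 2 : ℝ) ^ (2 * m + 1) *
            ((1 / 2 : ℝ) * ∑ i ∈ T, μ i)) := by ring
      _ ≤ (1 / 2 : ℝ) ^ ((2 * m + 2) * n) * ((1 / 2 : ℝ) ^ (2 * m + 1) * ∑ i ∈ T', μ i) := by
          gcongr
      _ ≤ (1 / 2 : ℝ) ^ ((2 * m + 2) * n) * ∑ i ∈ T'', μ i := by gcongr
      _ = ∑ a ∈ X, (1 / 2 : ℝ) ^ ((2 * m + 2) * n) * ∑ i ∈ T'' with idx (w i) = a, μ i := by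
          rw [hfib1, Finset.mul_sum]
      _ ≤ ∑ a ∈ X, ∑ i ∈ T'' with idx (w i) = a ∧ w i ∈ Q a ∧ ∀ q ∈ Q a, ¬ Bad i q, μ i :=
          Finset.sum_le_sum fun a _ => hQm a
      _ ≤ _ := hfib2

/-- A walk from `a` to `b` of length `L` along the relation `R`, without repeated vertices. -/
structure IsSimpleWalk (R : V → V → Prop) (a b : V) (L : ℕ) (r : ℕ → V) : Prop where
  zero : r 0 = a
  of_le : ∀ m, L ≤ m → r m = b
  step : ∀ m < L, R (r m) (r (m + 1))
  inj : ∀ m n, m ≤ L → n ≤ L → r m = r n → m = n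

theorem exists_isSimpleWalk {R : V → V → Prop} {a b : V} (h : Relation.ReflTransGen R a b) :
    ∃ L r, IsSimpleWalk R a b L r := by
  induction h using Relation.ReflTransGen.head_induction_on with
  | refl => exact ⟨0, fun _ => b, rfl, fun _ _ => rfl, by simp, by intro m n; omega⟩
  | head hac hcb ih =>
    rename_i a c
    obtain ⟨L, r, hr⟩ := ih
    by_cases hex : ∃ m ≤ L, r m = a
    · obtain ⟨m, hm, rfl⟩ := hex
      refine ⟨L - m, fun i => r (m + i), by simp, fun i hi => hr.of_le _ (by omega),
        fun i hi => hr.step _ (by omega), fun i j hi hj hij => ?_⟩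
      have := hr.inj _ _ (by omega) (by omega) hij
      omega
    · refine ⟨L + 1, fun i => Nat.casesOn i a r, rfl, ?_, ?_, ?_⟩
      · rintro (_ | m) hm
        · omega
        · exact hr.of_le m (by omega)
      · rintro (_ | m) hm
        · change R a (r 0); rw [hr.zero]; exact hac
        · exact hr.step m (by omega)
      · rintro (_ | m) (_ | n) hm hn hmn
        · rfl
        · exact absurd ⟨n, by omega, hmn.symm⟩ hex
        · exact absurd ⟨m, by omega, hmn⟩ hex
        · rw [hr.inj m n (by omega) (by omega) hmn]

/-- The number of times the walk `r` of length `L` uses the arc `(x, y)`. -/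
noncomputable def arcCount (r : ℕ → V) (L : ℕ) (x y : V) : ℤ :=
  ∑ m ∈ Finset.range L, if r m = x ∧ r (m + 1) = y then 1 else 0

theorem arcCount_nonneg (r : ℕ → V) (L : ℕ) (x y : V) : 0 ≤ arcCount r L x y :=
  Finset.sum_nonneg fun m _ => by split_ifs <;> simp

theorem arcCount_eq_card (r : ℕ → V) (L : ℕ) (x y : V) :
    arcCount r L x y = ((Finset.range L).filter fun m => r m = x ∧ r (m + 1) = y).card := by
  simp [arcCount]

theorem one_le_arcCount {r : ℕ → V} {L m : ℕ} (hm : m < L) :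
    1 ≤ arcCount r L (r m) (r (m + 1)) := by
  rw [arcCount_eq_card]
  have : 0 < ((Finset.range L).filter fun n => r n = r m ∧ r (n + 1) = r (m + 1)).card :=
    Finset.card_pos.2 ⟨m, by simp [hm]⟩
  omega

theorem arcCount_eq_zero {r : ℕ → V} {L : ℕ} {x y : V}
    (h : ∀ m < L, ¬ (r m = x ∧ r (m + 1) = y)) : arcCount r L x y = 0 :=
  Finset.sum_eq_zero fun m hm => if_neg (h m (Finset.mem_range.1 hm))

/-- The excess of the out-flow over the in-flow at `v`. -/
def netOut [Fintype V] (φ : V → V → ℤ) (v : V) : ℤ := ∑ y, φ v y - ∑ x, φ x v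

theorem netOut_add [Fintype V] (φ ψ : V → V → ℤ) (v : V) :
    netOut (fun x y => φ x y + ψ x y) v = netOut φ v + netOut ψ v := by
  simp only [netOut, Finset.sum_add_distrib]; ring

theorem netOut_sub [Fintype V] (φ ψ : V → V → ℤ) (v : V) :
    netOut (fun x y => φ x y - ψ x y) v = netOut φ v - netOut ψ v := by
  simp only [netOut, Finset.sum_sub_distrib]; ring

theorem netOut_sum [Fintype V] {ι : Type*} (I : Finset ι) (φ : ι → V → V → ℤ) (v : V) :
    netOut (fun x y => ∑ i ∈ I, φ i x y) v = ∑ i ∈ I, netOut (φ i) v := by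
  simp only [netOut, Finset.sum_sub_distrib]
  congr 1 <;> exact Finset.sum_comm

theorem netOut_single [Fintype V] (a b v : V) :
    netOut (fun x y => if a = x ∧ b = y then 1 else 0) v =
      (if a = v then 1 else 0) - (if b = v then 1 else 0) := by
  simp only [netOut]
  congr 1
  · by_cases h : a = v <;> simp [h]
  · by_cases h : b = v <;> simp [h]

theorem netOut_neg_single [Fintype V] (a b v : V) :
    netOut (fun x y => - if b = x ∧ a = y then 1 else 0) v =
      (if a = v then 1 else 0) - (if b = v then 1 else 0) := by
  have := netOut_single b a v
  simp only [netOut, Finset.sum_neg_distrib] at this ⊢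
  linarith

theorem sum_range_indicator_sub (r : ℕ → V) (L : ℕ) (v : V) :
    ∑ m ∈ Finset.range L, ((if r m = v then (1 : ℤ) else 0) - if r (m + 1) = v then 1 else 0) =
      (if r 0 = v then 1 else 0) - if r L = v then 1 else 0 :=
  Finset.sum_range_sub' (fun m => if r m = v then (1 : ℤ) else 0) L

theorem netOut_arcCount [Fintype V] (r : ℕ → V) (L : ℕ) (v : V) :
    netOut (arcCount r L) v = (if r 0 = v then 1 else 0) - if r L = v then 1 else 0 := by
  rw [← sum_range_indicator_sub]
  unfold arcCount
  rw [netOut_sum]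
  exact Finset.sum_congr rfl fun m _ => netOut_single _ _ _

theorem IsSimpleWalk.arcCount_le_one {R : V → V → Prop} {a b : V} {L : ℕ} {r : ℕ → V}
    (h : IsSimpleWalk R a b L r) (x y : V) : arcCount r L x y ≤ 1 := by
  rw [arcCount_eq_card]
  have : ((Finset.range L).filter fun m => r m = x ∧ r (m + 1) = y).card ≤ 1 := by
    rw [Finset.card_le_one]
    intro m hm n hn
    simp only [Finset.mem_filter, Finset.mem_range] at hm hn
    exact h.inj m n hm.1.le hn.1.le (hm.2.1.trans hn.2.1.symm)
  exact_mod_cast this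

/-- Flow decomposition. -/
theorem exists_walks_of_netOut [Fintype V] {s t : V} (n : ℕ) :
    ∀ φ : V → V → ℤ, (∀ x y, 0 ≤ φ x y) →
      (∀ v, netOut φ v = n * ((if s = v then 1 else 0) - if t = v then 1 else 0)) →
      ∃ (L : Fin n → ℕ) (r : Fin n → ℕ → V),
        (∀ i, r i 0 = s ∧ (∀ m, L i ≤ m → r i m = t)) ∧
        ∀ x y, ∑ i, arcCount (r i) (L i) x y ≤ φ x y := by
  induction n with
  | zero =>
    intro φ hφ _
    exact ⟨Fin.elim0, Fin.elim0, fun i => i.elim0, fun x y => by simpa using hφ x y⟩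
  | succ n ih =>
    intro φ hφ hnet
    have hreach : Relation.ReflTransGen (fun x y => 0 < φ x y) s t := by
      by_contra hcon
      set X := Finset.univ.filter fun v => Relation.ReflTransGen (fun x y => 0 < φ x y) s v with hX
      have hsX : s ∈ X := by simp [hX, Relation.ReflTransGen.refl]
      have htX : t ∉ X := by simpa [hX] using hcon
      have hout : ∀ x ∈ X, ∀ y ∉ X, φ x y = 0 := by
        intro x hx y hy
        by_contra hne
        have hpos : 0 < φ x y := lt_of_le_of_ne (hφ x y) (Ne.symm hne)
        simp only [hX, Finset.mem_filter, Finset.mem_univ, true_and] at hx hy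
        exact hy (hx.tail hpos)
      have h1 : ∑ v ∈ X, netOut φ v = n + 1 := by
        rw [Finset.sum_congr rfl fun v _ => hnet v, ← Finset.mul_sum, Finset.sum_sub_distrib]
        simp [hsX, htX]
      have h2 : ∑ v ∈ X, netOut φ v ≤ 0 := by
        unfold netOut
        rw [Finset.sum_sub_distrib]
        have h3 : ∑ v ∈ X, ∑ y, φ v y = ∑ v ∈ X, ∑ y ∈ X, φ v y := by
          refine Finset.sum_congr rfl fun v hv => ?_
          exact (Finset.sum_subset (Finset.subset_univ X) fun y _ hy => hout v hv y hy).symm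
        have h4 : ∑ v ∈ X, ∑ x ∈ X, φ x v ≤ ∑ v ∈ X, ∑ x, φ x v :=
          Finset.sum_le_sum fun v _ =>
            Finset.sum_le_sum_of_subset_of_nonneg (Finset.subset_univ X) fun x _ _ => hφ x v
        have h5 : ∑ v ∈ X, ∑ x ∈ X, φ x v = ∑ v ∈ X, ∑ y ∈ X, φ v y := Finset.sum_comm
        linarith
      have : (0 : ℤ) ≤ n := Int.natCast_nonneg n
      omega
    obtain ⟨L0, r0, h0⟩ := exists_isSimpleWalk hreach
    have hle : ∀ x y, arcCount r0 L0 x y ≤ φ x y := by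
      intro x y
      by_cases hex : ∃ m < L0, r0 m = x ∧ r0 (m + 1) = y
      · obtain ⟨m, hm, rfl, rfl⟩ := hex
        exact (h0.arcCount_le_one _ _).trans (h0.step m hm)
      · rw [arcCount_eq_zero fun m hm hh => hex ⟨m, hm, hh⟩]
        exact hφ x y
    obtain ⟨L, r, hr, hcount⟩ := ih (fun x y => φ x y - arcCount r0 L0 x y)
      (fun x y => sub_nonneg.2 (hle x y)) (fun v => by
        rw [netOut_sub, hnet, netOut_arcCount, h0.zero, h0.of_le L0 le_rfl]
        push_cast; ring)
    refine ⟨Fin.cons L0 L, Fin.cons r0 r, ?_, ?_⟩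
    · intro i
      refine Fin.cases ?_ (fun j => ?_) i
      · exact ⟨h0.zero, h0.of_le⟩
      · exact hr j
    · intro x y
      rw [Fin.sum_univ_succ]
      simp only [Fin.cons_zero, Fin.cons_succ]
      have := hcount x y
      linarith

/-- A family of `lam` walks from `s` to `t` using arcs of `E ∪ A` in which every arc outside `A` is
used at most once. -/
structure WalkFlow (E A : Finset (V × V)) (s t : V) (lam : ℕ) where
  /-- The lengths of the walks. -/
  len : Fin lam → ℕ
  /-- The vertices of the walks. -/
  vert : Fin lam → ℕ → V
  vert_zero : ∀ i, vert i 0 = s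
  vert_of_le : ∀ i m, len i ≤ m → vert i m = t
  arc_mem : ∀ i, ∀ m < len i, (vert i m, vert i (m + 1)) ∈ E ∨ (vert i m, vert i (m + 1)) ∈ A
  disj : ∀ i j, ∀ m < len i, ∀ n < len j, vert i m = vert j n → vert i (m + 1) = vert j (n + 1) →
    (vert i m, vert i (m + 1)) ∉ A → i = j ∧ m = n

namespace WalkFlow

variable {E A : Finset (V × V)} {s t : V} {lam : ℕ}

/-- The arc `(x, y)` is used by a walk of the flow. -/
def Uses (W : WalkFlow E A s t lam) (x y : V) : Prop :=
  ∃ i, ∃ m < W.len i, W.vert i m = x ∧ W.vert i (m + 1) = y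

/-- The arcs of the residual graph. -/
def Res (W : WalkFlow E A s t lam) (x y : V) : Prop :=
  ((x, y) ∈ A ∨ ((x, y) ∈ E ∧ ¬ W.Uses x y)) ∨ W.Uses y x

/-- A residual path from `s` to `t` allows one to enlarge the flow. -/
theorem exists_augment [Fintype V] (W : WalkFlow E A s t lam)
    (h : Relation.ReflTransGen W.Res s t) : Nonempty (WalkFlow E A s t (lam + 1)) := by
  obtain ⟨L, r, hr⟩ := exists_isSimpleWalk h
  set fwd : V → V → Prop := fun x y => (x, y) ∈ A ∨ ((x, y) ∈ E ∧ ¬ W.Uses x y) with hfwd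
  set φ : V → V → ℤ := fun x y => ∑ i, arcCount (W.vert i) (W.len i) x y with hφ
  set δ : ℕ → V → V → ℤ := fun m x y =>
    if fwd (r m) (r (m + 1)) then (if r m = x ∧ r (m + 1) = y then 1 else 0)
    else - (if r (m + 1) = x ∧ r m = y then 1 else 0) with hδ
  set Δ : V → V → ℤ := fun x y => ∑ m ∈ Finset.range L, δ m x y with hΔ
  have hφ1 : ∀ x y, W.Uses x y → 1 ≤ φ x y := by
    rintro x y ⟨i, m, hm, rfl, rfl⟩
    refine (one_le_arcCount (r := W.vert i) hm).trans ?_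
    exact Finset.single_le_sum (f := fun i' =>
      arcCount (W.vert i') (W.len i') (W.vert i m) (W.vert i (m + 1)))
      (fun i _ => arcCount_nonneg _ _ _ _) (Finset.mem_univ i)
  have hφz : ∀ x y, ¬ W.Uses x y → φ x y = 0 := fun x y hu =>
    Finset.sum_eq_zero fun i _ => arcCount_eq_zero fun m hm hh => hu ⟨i, m, hm, hh⟩
  have hφle : ∀ x y, (x, y) ∉ A → φ x y ≤ 1 := by
    intro x y hA
    by_cases hu : W.Uses x y
    · obtain ⟨i, m, hm, rfl, rfl⟩ := hu
      simp only [hφ]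
      rw [Finset.sum_eq_single i]
      · rw [arcCount_eq_card]
        have : ((Finset.range (W.len i)).filter fun n =>
            W.vert i n = W.vert i m ∧ W.vert i (n + 1) = W.vert i (m + 1)).card ≤ 1 := by
          rw [Finset.card_le_one]
          have key : ∀ n ∈ (Finset.range (W.len i)).filter fun n =>
              W.vert i n = W.vert i m ∧ W.vert i (n + 1) = W.vert i (m + 1), n = m := by
            intro n hn
            simp only [Finset.mem_filter, Finset.mem_range] at hn
            exact ((W.disj i i m hm n hn.1 hn.2.1.symm hn.2.2.symm hA).2).symm
          intro a ha b hb
          rw [key a ha, key b hb]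
        exact_mod_cast this
      · intro j _ hj
        refine arcCount_eq_zero fun n hn hh => hj ?_
        exact (W.disj i j m hm n hn hh.1.symm hh.2.symm hA).1.symm
      · simp
    · rw [hφz x y hu]; norm_num
  have hind : ∀ {p q : Prop} [Decidable p] [Decidable q],
      (p → q) → (if p then (1 : ℤ) else 0) ≤ if q then 1 else 0 := by
    intro p q _ _ hpq
    by_cases hp : p
    · simp [hp, hpq hp]
    · rw [if_neg hp]; split_ifs <;> simp
  have hΔle : ∀ x y, Δ x y ≤ 1 ∧ (¬ fwd x y → Δ x y ≤ 0) := by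
    intro x y
    have hle : ∀ m ∈ Finset.range L, δ m x y ≤
        if fwd x y ∧ r m = x ∧ r (m + 1) = y then 1 else 0 := by
      intro m _
      simp only [hδ]
      by_cases hf : fwd (r m) (r (m + 1))
      · rw [if_pos hf]
        refine hind fun hxy => ⟨?_, hxy⟩
        rwa [hxy.1, hxy.2] at hf
      · rw [if_neg hf]
        exact (neg_nonpos.2 (by split_ifs <;> simp)).trans (by split_ifs <;> simp)
    have h1 := Finset.sum_le_sum hle
    constructor
    · refine h1.trans ((Finset.sum_le_sum fun m _ => ?_).trans (hr.arcCount_le_one x y))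
      exact hind fun h => h.2
    · intro hf
      simpa [hf] using h1
  have hΔge : ∀ x y, -1 ≤ Δ x y ∧ (¬ W.Uses x y → 0 ≤ Δ x y) := by
    intro x y
    have hle : ∀ m ∈ Finset.range L,
        (-if W.Uses x y ∧ r m = y ∧ r (m + 1) = x then (1 : ℤ) else 0) ≤ δ m x y := by
      intro m hm
      have hstep := hr.step m (Finset.mem_range.1 hm)
      simp only [hδ]
      by_cases hf : fwd (r m) (r (m + 1))
      · rw [if_pos hf]; split_ifs <;> simp
      · rw [if_neg hf]
        have hu : W.Uses (r (m + 1)) (r m) := hstep.resolve_left hf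
        by_cases hxy : r (m + 1) = x ∧ r m = y
        · obtain ⟨rfl, rfl⟩ := hxy
          simp [hu]
        · rw [if_neg hxy]; split_ifs <;> simp
    have h1 := Finset.sum_le_sum hle
    rw [Finset.sum_neg_distrib] at h1
    constructor
    · refine le_trans (neg_le_neg ?_) h1
      refine (Finset.sum_le_sum fun m _ => ?_).trans (hr.arcCount_le_one y x)
      exact hind fun h => h.2
    · intro hf
      simpa [hf] using h1
  have hnetφ : ∀ v, netOut φ v = lam * ((if s = v then 1 else 0) - if t = v then 1 else 0) := by
    intro v
    simp only [hφ]
    rw [netOut_sum]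
    simp only [netOut_arcCount, W.vert_zero, W.vert_of_le _ _ le_rfl]
    rw [Finset.sum_const, Finset.card_univ, Fintype.card_fin, nsmul_eq_mul]
  have hnetΔ : ∀ v, netOut Δ v = (if s = v then 1 else 0) - if t = v then 1 else 0 := by
    intro v
    have hrL : r L = t := hr.of_le L le_rfl
    rw [← hr.zero, ← hrL, ← sum_range_indicator_sub]
    simp only [hΔ]
    rw [netOut_sum]
    refine Finset.sum_congr rfl fun m _ => ?_
    by_cases hf : fwd (r m) (r (m + 1))
    · rw [← netOut_single]
      simp only [hδ, if_pos hf]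
    · rw [← netOut_neg_single]
      simp only [hδ, if_neg hf]
  obtain ⟨L', r', hr', hcount⟩ :=
    exists_walks_of_netOut (s := s) (t := t) (lam + 1) (fun x y => φ x y + Δ x y)
    (fun x y => by
      by_cases hu : W.Uses x y
      · have := hφ1 x y hu; have := (hΔge x y).1; linarith
      · have := hφz x y hu; have := (hΔge x y).2 hu; linarith)
    (fun v => by rw [netOut_add, hnetφ, hnetΔ]; push_cast; ring)
  have hle1 : ∀ x y, (x, y) ∉ A → φ x y + Δ x y ≤ 1 := by
    intro x y hA
    by_cases hf : fwd x y
    · have hu : ¬ W.Uses x y := (hf.resolve_left hA).2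
      have := hφz x y hu; have := (hΔle x y).1; linarith
    · have := hφle x y hA; have := (hΔle x y).2 hf; linarith
  have hsingle : ∀ x y i, arcCount (r' i) (L' i) x y ≤ φ x y + Δ x y := fun x y i =>
    (Finset.single_le_sum (f := fun i => arcCount (r' i) (L' i) x y)
      (fun i _ => arcCount_nonneg _ _ _ _) (Finset.mem_univ i)).trans (hcount x y)
  refine ⟨⟨L', r', fun i => (hr' i).1, fun i => (hr' i).2, ?_, ?_⟩⟩
  · intro i m hm
    by_contra hcon
    push Not at hcon
    have h1 := (one_le_arcCount hm).trans (hsingle _ _ i)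
    have hf : ¬ fwd (r' i m) (r' i (m + 1)) := by
      rintro (h | h)
      · exact hcon.2 h
      · exact hcon.1 h.1
    have hu : ¬ W.Uses (r' i m) (r' i (m + 1)) := by
      rintro ⟨j, n, hn, h1, h2⟩
      have := W.arc_mem j n hn
      rw [h1, h2] at this
      exact this.elim hcon.1 hcon.2
    have h2 := hφz _ _ hu
    have h3 := (hΔle (r' i m) (r' i (m + 1))).2 hf
    linarith
  · intro i j m hm n hn h1 h2 hA
    have hle := hle1 _ _ hA
    have hij : i = j := by
      by_contra hne
      have h3 := one_le_arcCount (r := r' i) hm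
      have h4 := one_le_arcCount (r := r' j) hn
      rw [← h1, ← h2] at h4
      have h5 : ∑ l ∈ ({i, j} : Finset (Fin (lam + 1))),
          arcCount (r' l) (L' l) (r' i m) (r' i (m + 1)) ≤ _ :=
        (Finset.sum_le_sum_of_subset_of_nonneg (Finset.subset_univ _)
          fun l _ _ => arcCount_nonneg _ _ _ _).trans (hcount _ _)
      rw [Finset.sum_pair hne] at h5
      linarith
    subst hij
    refine ⟨rfl, ?_⟩
    by_contra hne
    have h3 := (hsingle (r' i m) (r' i (m + 1)) i).trans hle
    rw [arcCount_eq_card] at h3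
    have h4 : 1 < ((Finset.range (L' i)).filter fun k =>
        r' i k = r' i m ∧ r' i (k + 1) = r' i (m + 1)).card :=
      Finset.one_lt_card.2 ⟨m, by simp [hm], n, by simp [hn, h1, h2], hne⟩
    omega

end WalkFlow

theorem source_mem_sSide (E : Finset (V × V)) (s : V) (Z : Finset (V × V)) : s ∈ sSide E s Z :=
  Relation.ReflTransGen.refl

namespace IsStarCut

variable {E Z : Finset (V × V)} {s t : V}

theorem sink_notMem (hZ : IsStarCut E s t Z) : t ∉ sSide E s Z := hZ.1.2

theorem mem_of_leaves (_hZ : IsStarCut E s t Z) {x y : V} (hE : (x, y) ∈ E)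
    (hx : x ∈ sSide E s Z) (hy : y ∉ sSide E s Z) : (x, y) ∈ Z := by
  by_contra hcon
  exact hy (Relation.ReflTransGen.tail hx ⟨hE, hcon⟩)

end IsStarCut

namespace WalkFlow

variable {E A : Finset (V × V)} {s t : V} {lam : ℕ}

/-- Reachability in the residual graph. -/
def RR (W : WalkFlow E A s t lam) : V → V → Prop := Relation.ReflTransGen W.Res

theorem RR.trans {W : WalkFlow E A s t lam} {x y z : V} (h : W.RR x y) (h' : W.RR y z) :
    W.RR x z := Relation.ReflTransGen.trans h h'

theorem rr_refl (W : WalkFlow E A s t lam) (x : V) : W.RR x x := Relation.ReflTransGen.refl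

theorem rr_vert_succ (W : WalkFlow E A s t lam) (i : Fin lam) (m : ℕ) :
    W.RR (W.vert i (m + 1)) (W.vert i m) := by
  by_cases hm : m < W.len i
  · exact Relation.ReflTransGen.single (Or.inr ⟨i, m, hm, rfl, rfl⟩)
  · rw [W.vert_of_le i m (by omega), W.vert_of_le i (m + 1) (by omega)]
    exact W.rr_refl t

theorem rr_of_succ (W : WalkFlow E A s t lam) {f : ℕ → V}
    (hf : ∀ n, W.RR (f (n + 1)) (f n)) {m n : ℕ} (hmn : m ≤ n) : W.RR (f n) (f m) := by
  induction n, hmn using Nat.le_induction with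
  | base => exact W.rr_refl _
  | succ n _ ih => exact (hf n).trans ih

theorem rr_vert (W : WalkFlow E A s t lam) (i : Fin lam) {m n : ℕ} (hmn : m ≤ n) :
    W.RR (W.vert i n) (W.vert i m) :=
  W.rr_of_succ (W.rr_vert_succ i) hmn

theorem rr_sink_vert (W : WalkFlow E A s t lam) (i : Fin lam) (m : ℕ) : W.RR t (W.vert i m) := by
  have := W.rr_vert i (le_max_left m (W.len i))
  rwa [W.vert_of_le i _ (le_max_right _ _)] at this

/-- The first position on walk `i` from which `q` is reachable in the residual graph. -/
noncomputable def first (W : WalkFlow E A s t lam) (i : Fin lam) (q : V) : ℕ :=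
  sInf {m | W.RR (W.vert i m) q}

theorem rr_first (W : WalkFlow E A s t lam) (i : Fin lam) {q : V} (hq : W.RR t q) :
    W.RR (W.vert i (W.first i q)) q := by
  have : (W.len i) ∈ {m | W.RR (W.vert i m) q} := by
    change W.RR (W.vert i (W.len i)) q
    rwa [W.vert_of_le i _ le_rfl]
  exact Nat.sInf_mem ⟨_, this⟩

theorem first_le (W : WalkFlow E A s t lam) {i : Fin lam} {q : V} {m : ℕ}
    (h : W.RR (W.vert i m) q) : W.first i q ≤ m := Nat.sInf_le h

theorem first_mono (W : WalkFlow E A s t lam) (i : Fin lam) {x y : V} (hx : W.RR t x)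
    (hxy : W.RR x y) : W.first i y ≤ W.first i x :=
  W.first_le ((W.rr_first i hx).trans hxy)

/-- `q` is residually reachable from a vertex of the `s`-side of `Z`. -/
def Alive (W : WalkFlow E A s t lam) (Z : Finset (V × V)) (q : V) : Prop :=
  ∃ v ∈ sSide E s Z, W.RR v q

theorem alive_of_mem (W : WalkFlow E A s t lam) {Z : Finset (V × V)} {q : V}
    (hq : q ∈ sSide E s Z) : W.Alive Z q := ⟨q, hq, W.rr_refl q⟩

theorem Alive.of_rr {W : WalkFlow E A s t lam} {Z : Finset (V × V)} {x y : V}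
    (h : W.Alive Z x) (hxy : W.RR x y) : W.Alive Z y := by
  obtain ⟨v, hv, hvx⟩ := h
  exact ⟨v, hv, hvx.trans hxy⟩

theorem exists_first_mem (W : WalkFlow E A s t lam) {Z : Finset (V × V)} {q : V}
    (hq : W.Alive Z q) (hs : ¬ W.RR s q ∨ 0 < lam) :
    ∃ i, W.vert i (W.first i q) ∈ sSide E s Z := by
  by_cases hsq : W.RR s q
  · have hlam := hs.resolve_left (not_not.2 hsq)
    refine ⟨⟨0, hlam⟩, ?_⟩
    have : W.first ⟨0, hlam⟩ q = 0 := Nat.le_zero.1 (W.first_le (by rwa [W.vert_zero]))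
    rw [this, W.vert_zero]
    exact source_mem_sSide E s Z
  · by_contra hcon
    push Not at hcon
    obtain ⟨v, hv, hvq⟩ := hq
    revert hvq
    change ¬ W.RR v q
    have hv' : Relation.ReflTransGen (fun u v => (u, v) ∈ (E : Set (V × V)) \ Z) s v := hv
    clear hv
    induction hv' with
    | refl => exact hsq
    | tail hsu huv ih =>
      rename_i u v
      intro hvq
      by_cases hu : W.Uses u v
      · obtain ⟨i, m, hm, rfl, rfl⟩ := hu
        have h1 := W.first_le hvq
        rcases Nat.lt_or_ge (W.first i q) (m + 1) with h2 | h2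
        · have h3 : W.RR (W.vert i (W.first i q)) q :=
            Nat.sInf_mem (s := {m | W.RR (W.vert i m) q}) ⟨_, hvq⟩
          exact ih ((W.rr_vert i (by omega)).trans h3)
        · have h3 : W.first i q = m + 1 := le_antisymm h1 h2
          apply hcon i
          rw [h3]
          exact Relation.ReflTransGen.tail hsu huv
      · exact ih (Relation.ReflTransGen.head (Or.inl (Or.inr ⟨huv.1, hu⟩)) hvq)

/-- The vertices of the `s`-side of `Z` with a residual arc leaving the `s`-side. -/
noncomputable def exitSources [Fintype V] (W : WalkFlow E A s t lam) (Z : Finset (V × V)) :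
    Finset V :=
  Finset.univ.filter fun x => x ∈ sSide E s Z ∧ ∃ y ∉ sSide E s Z, W.Res x y

theorem exists_exitSource [Fintype V] (W : WalkFlow E A s t lam) {Z : Finset (V × V)} {p q : V}
    (hp : p ∈ sSide E s Z) (hq : q ∉ sSide E s Z) (hpq : W.RR p q) :
    ∃ x ∈ W.exitSources Z, W.RR p x ∧ W.RR x q := by
  have h : Relation.ReflTransGen W.Res p q := hpq
  induction h using Relation.ReflTransGen.head_induction_on with
  | refl => exact absurd hp hq
  | head hac hcq ih =>
    rename_i a c
    by_cases hc : c ∈ sSide E s Z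
    · obtain ⟨x, hx, hcx, hxq⟩ := ih hc hcq
      exact ⟨x, hx, Relation.ReflTransGen.head hac hcx, hxq⟩
    · exact ⟨a, by simpa [exitSources, hp] using ⟨c, hc, hac⟩, W.rr_refl a, hpq⟩

/-- The positions at which walk `i` leaves the `s`-side of `Z`. -/
noncomputable def exits (W : WalkFlow E A s t lam) (Z : Finset (V × V)) (i : Fin lam) :
    Finset ℕ :=
  (Finset.range (W.len i)).filter fun m =>
    W.vert i m ∈ sSide E s Z ∧ W.vert i (m + 1) ∉ sSide E s Z

/-- The positions at which walk `i` enters the `s`-side of `Z`. -/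
noncomputable def entries (W : WalkFlow E A s t lam) (Z : Finset (V × V)) (i : Fin lam) :
    Finset ℕ :=
  (Finset.range (W.len i)).filter fun m =>
    W.vert i m ∉ sSide E s Z ∧ W.vert i (m + 1) ∈ sSide E s Z

theorem card_entries_add_one (W : WalkFlow E A s t lam) {Z : Finset (V × V)}
    (hZ : IsStarCut E s t Z) (i : Fin lam) : (W.entries Z i).card + 1 = (W.exits Z i).card := by
  have h := Finset.sum_range_sub'
    (fun m => if W.vert i m ∈ sSide E s Z then (1 : ℤ) else 0) (W.len i)
  rw [W.vert_zero, W.vert_of_le i _ le_rfl, if_pos (source_mem_sSide E s Z),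
    if_neg hZ.sink_notMem] at h
  have h2 : ∑ m ∈ Finset.range (W.len i), ((if W.vert i m ∈ sSide E s Z then (1 : ℤ) else 0) -
      if W.vert i (m + 1) ∈ sSide E s Z then 1 else 0) =
      (W.exits Z i).card - (W.entries Z i).card := by
    simp only [exits, entries, Finset.card_filter]
    push_cast
    rw [← Finset.sum_sub_distrib]
    refine Finset.sum_congr rfl fun m _ => ?_
    by_cases h1 : W.vert i m ∈ sSide E s Z <;> by_cases h2 : W.vert i (m + 1) ∈ sSide E s Z <;>
      simp [h1, h2]
  omega

theorem arc_mem_of_leaves (W : WalkFlow E A s t lam) {Z : Finset (V × V)}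
    (hZ : IsStarCut E s t Z) (hA : Compatible E s Z A) {i : Fin lam} {m : ℕ}
    (h1 : W.vert i m ∈ sSide E s Z) (h2 : W.vert i (m + 1) ∉ sSide E s Z) :
    m < W.len i ∧ (W.vert i m, W.vert i (m + 1)) ∈ Z ∧
      (W.vert i m, W.vert i (m + 1)) ∉ A := by
  have hm : m < W.len i := by
    by_contra hcon
    rw [W.vert_of_le i m (by omega)] at h1
    exact hZ.sink_notMem h1
  have h3 : (W.vert i m, W.vert i (m + 1)) ∉ A := fun h => h2 (hA _ h h1)
  exact ⟨hm, hZ.mem_of_leaves ((W.arc_mem i m hm).resolve_right h3) h1 h2, h3⟩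

theorem sum_card_exits_le (W : WalkFlow E A s t lam) {Z : Finset (V × V)}
    (hZ : IsStarCut E s t Z) (hA : Compatible E s Z A) : ∑ i, (W.exits Z i).card ≤ Z.card := by
  rw [← Finset.card_sigma]
  refine Finset.card_le_card_of_injOn
    (fun p => (W.vert p.1 p.2, W.vert p.1 (p.2 + 1))) ?_ ?_
  · rintro ⟨i, m⟩ h
    simp only [exits, Finset.coe_sigma, Set.mem_sigma_iff, Finset.mem_coe, Finset.mem_filter] at h
    exact (W.arc_mem_of_leaves hZ hA h.2.2.1 h.2.2.2).2.1
  · rintro ⟨i, m⟩ h ⟨j, n⟩ h' heq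
    simp only [exits, Finset.coe_sigma, Set.mem_sigma_iff, Finset.mem_coe, Finset.mem_filter,
      Finset.mem_range] at h h'
    simp only [Prod.mk.injEq] at heq
    obtain ⟨rfl, rfl⟩ := W.disj i j m h.2.1 n h'.2.1 heq.1 heq.2
      (W.arc_mem_of_leaves hZ hA h.2.2.1 h.2.2.2).2.2
    rfl

theorem le_card (W : WalkFlow E A s t lam) {Z : Finset (V × V)}
    (hZ : IsStarCut E s t Z) (hA : Compatible E s Z A) : lam ≤ Z.card := by
  refine le_trans ?_ (W.sum_card_exits_le hZ hA)
  have : ∑ _i : Fin lam, 1 ≤ ∑ i, (W.exits Z i).card :=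
    Finset.sum_le_sum fun i _ => by have := W.card_entries_add_one hZ i; omega
  simpa using this

theorem card_exitSources_le [Fintype V] (W : WalkFlow E A s t lam) {Z : Finset (V × V)}
    (hZ : IsStarCut E s t Z) (hA : Compatible E s Z A) :
    (W.exitSources Z).card ≤ 2 * Z.card := by
  have hsub : W.exitSources Z ⊆ Z.image Prod.fst ∪
      Finset.univ.biUnion fun i => (W.entries Z i).image fun m => W.vert i (m + 1) := by
    intro x hx
    simp only [exitSources, Finset.mem_filter, Finset.mem_univ, true_and] at hx
    obtain ⟨hxS, y, hy, hres⟩ := hx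
    rw [Finset.mem_union]
    rcases hres with (h | h) | ⟨i, m, hm, h1, h2⟩
    · exact absurd (hA _ h hxS) hy
    · exact Or.inl (Finset.mem_image.2 ⟨_, hZ.mem_of_leaves h.1 hxS hy, rfl⟩)
    · refine Or.inr (Finset.mem_biUnion.2 ⟨i, Finset.mem_univ i, Finset.mem_image.2 ⟨m, ?_, h2⟩⟩)
      simp only [entries, Finset.mem_filter, Finset.mem_range]
      exact ⟨hm, h1 ▸ hy, h2 ▸ hxS⟩
  have h1 := Finset.card_le_card hsub
  have h2 := Finset.card_union_le (Z.image Prod.fst)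
    (Finset.univ.biUnion fun i => (W.entries Z i).image fun m => W.vert i (m + 1))
  have h3 : (Z.image Prod.fst).card ≤ Z.card := Finset.card_image_le
  have h4 : (Finset.univ.biUnion fun i => (W.entries Z i).image fun m => W.vert i (m + 1)).card ≤
      ∑ i, (W.exits Z i).card :=
    Finset.card_biUnion_le.trans (Finset.sum_le_sum fun i _ =>
      Finset.card_image_le.trans (by have := W.card_entries_add_one hZ i; omega))
  have h5 := W.sum_card_exits_le hZ hA
  omega

/-- The last index `h` for which `f h` is residually reachable from `x`. -/
noncomputable def lastReach (W : WalkFlow E A s t lam) (f : ℕ → V) (x : V) : ℕ :=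
  sInf {h | ¬ W.RR x (f h)} - 1

theorem le_lastReach (W : WalkFlow E A s t lam) {f : ℕ → V} (hf : ∀ n, W.RR (f (n + 1)) (f n))
    {x : V} {b h : ℕ} (hb : ¬ W.RR x (f b)) (hh : W.RR x (f h)) : h ≤ W.lastReach f x := by
  have hmem : ¬ W.RR x (f (sInf {h | ¬ W.RR x (f h)})) :=
    Nat.sInf_mem (s := {h | ¬ W.RR x (f h)}) ⟨b, hb⟩
  have : h < sInf {h | ¬ W.RR x (f h)} := by
    by_contra hcon
    exact hmem (hh.trans (W.rr_of_succ hf (not_lt.1 hcon)))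
  unfold lastReach
  omega

theorem rr_of_le_lastReach (W : WalkFlow E A s t lam) {f : ℕ → V}
    {x : V} {h g : ℕ} (hf : ∀ n, W.RR (f (n + 1)) (f n)) (hh : W.RR x (f h))
    (hg : g ≤ W.lastReach f x) : W.RR x (f g) := by
  by_contra hcon
  have h1 : sInf {h | ¬ W.RR x (f h)} ≤ g := Nat.sInf_le hcon
  have hmem : ¬ W.RR x (f (sInf {h | ¬ W.RR x (f h)})) :=
    Nat.sInf_mem (s := {h | ¬ W.RR x (f h)}) ⟨g, hcon⟩
  unfold lastReach at hg
  have h0 : sInf {h | ¬ W.RR x (f h)} = 0 := by omega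
  rw [h0] at hmem
  exact hmem (hh.trans (W.rr_of_succ hf (Nat.zero_le h)))

/-- Given two sequences of vertices along which the residual graph can be traversed backwards, and
for each cut `Z` an index `w Z` after which the sequences are dead, one can sample indices hitting
`w Z` such that earlier sampled indices point to vertices on the `s`-side of `Z`. -/
theorem exists_positions [Fintype V] (W : WalkFlow E A s t lam) (k : ℕ) (f : Bool → ℕ → V)
    (hf : ∀ b n, W.RR (f b (n + 1)) (f b n)) (hft : ∀ b n, W.RR t (f b n)) (hlam : 0 < lam)
    (T : Finset (Finset (V × V))) (μ : Finset (V × V) → ℝ) (hμ : ∀ Z, 0 ≤ μ Z)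
    (w : Finset (V × V) → ℕ) (hi : ℕ)
    (hT : ∀ Z ∈ T, IsStarCut E s t Z ∧ Z.card ≤ k ∧ Compatible E s Z A)
    (hw : ∀ Z ∈ T, 1 ≤ w Z ∧ w Z ≤ hi)
    (hdead : ∀ Z ∈ T, ∀ b, ∀ g > w Z, ¬ W.Alive Z (f b g))
    (halive : ∀ Z ∈ T, ∀ b, ∀ h < w Z, W.Alive Z (f b h))
    (hL : ∀ Z ∈ T, ∃ c b, ∀ h < w Z, W.first c (f b h) < W.first c (f b (w Z))) :
    ∃ Q : Finset ℕ, (∀ q ∈ Q, 1 ≤ q ∧ q ≤ hi) ∧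
      (1 / 2 : ℝ) ^ ((8 * k + 2) * (2 * lam)) * ∑ Z ∈ T, μ Z ≤
        ∑ Z ∈ T with w Z ∈ Q ∧ ∀ q ∈ Q, q < w Z → ∀ b, f b q ∈ sSide E s Z, μ Z := by
  obtain ⟨Q, hQ, hQm⟩ := exists_hitting_avoiding (C := Bool × Fin lam)
    (fun c h => W.first c.2 (f c.1 h))
    (fun c => monotone_nat_of_le_succ fun n => W.first_mono c.2 (hft _ _) (hf _ n)) μ hμ w
    (fun Z h => h < w Z ∧ ¬ (∀ b, f b h ∈ sSide E s Z) ∧ Z ∈ T)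
    (fun Z => Finset.univ.biUnion fun b => (W.exitSources Z).image fun x => W.lastReach (f b) x)
    (4 * k) (2 * lam) 1 hi T
    (by
      refine (Finset.card_le_univ _).trans ?_
      simp)
    hw
    (by
      rintro Z - h ⟨hhw, hb, hZ⟩
      refine ⟨hhw, ?_⟩
      push Not at hb
      obtain ⟨b, hb⟩ := hb
      obtain ⟨c, hc⟩ := W.exists_first_mem (halive Z hZ b h hhw) (Or.inr hlam)
      obtain ⟨x, hx, hpx, hxq⟩ := W.exists_exitSource hc hb (W.rr_first c (hft b h))
      have hxS : x ∈ sSide E s Z := by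
        simp only [exitSources, Finset.mem_filter] at hx
        exact hx.2.1
      have hnr : ¬ W.RR x (f b (w Z + 1)) := fun hr =>
        hdead Z hZ b _ (Nat.lt_succ_self _) ⟨x, hxS, hr⟩
      refine ⟨W.lastReach (f b) x, ?_, (b, c), W.le_lastReach (hf b) hnr hxq, ?_, ?_⟩
      · exact Finset.mem_biUnion.2 ⟨b, Finset.mem_univ b, Finset.mem_image.2 ⟨x, hx, rfl⟩⟩
      · intro g hg
        by_contra hcon
        have h1 := W.rr_of_le_lastReach (hf b) hxq (not_lt.1 hcon)
        have h2 : W.first c (f b g) ≤ W.first c (f b h) := W.first_le (hpx.trans h1)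
        exact absurd hg (not_lt.2 h2)
      · intro g hg
        have hle : W.first c (f b h) ≤ W.first c (f b g) :=
          W.first_mono c (hft b g) (W.rr_of_succ (hf b) (by omega))
        refine lt_of_le_of_ne hle fun heq => hdead Z hZ b g hg ⟨_, hc, ?_⟩
        rw [heq]
        exact W.rr_first c (hft b g))
    (by
      intro Z hZ
      obtain ⟨h1, h2, h3⟩ := hT Z hZ
      have h4 := W.card_exitSources_le h1 h3
      refine Finset.card_biUnion_le.trans ?_
      calc _ ≤ ∑ _b : Bool, (W.exitSources Z).card :=
            Finset.sum_le_sum fun b _ => Finset.card_image_le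
        _ ≤ 4 * k := by simp; omega)
    (by
      intro Z hZ
      obtain ⟨c, b, h⟩ := hL Z hZ
      exact ⟨(b, c), h⟩)
  refine ⟨Q, hQ, ?_⟩
  have he : 2 * (4 * k) + 2 = 8 * k + 2 := by ring
  rw [he] at hQm
  refine hQm.trans_eq (Finset.sum_congr ?_ fun _ _ => rfl)
  ext Z
  simp only [Finset.mem_filter, and_congr_right_iff]
  intro hZ _
  refine forall₂_congr fun q hq => ?_
  simp only [hZ, and_true, not_and, not_not]

end WalkFlow

theorem exists_list_of_reflTransGen {R : V → V → Prop} {a b : V}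
    (h : Relation.ReflTransGen R a b) :
    ∃ p : List V, p.IsChain R ∧ p.head? = some a ∧ p.getLast? = some b ∧
      ∀ e ∈ arcsOf p, R e.1 e.2 := by
  induction h using Relation.ReflTransGen.head_induction_on with
  | refl => exact ⟨[b], by simp, by simp, by simp, by simp [arcsOf]⟩
  | head hac hcb ih =>
    rename_i a c
    obtain ⟨p, hp, hhead, hlast, harcs⟩ := ih
    cases p with
    | nil => simp at hhead
    | cons d p =>
      simp only [List.head?_cons, Option.some.injEq] at hhead
      subst hhead
      refine ⟨a :: d :: p, ?_, by simp, by simpa using hlast, ?_⟩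
      · exact List.IsChain.cons_cons hac hp
      · intro e he
        simp only [arcsOf, List.tail_cons, List.zip_cons_cons, List.mem_cons] at he
        rcases he with rfl | he
        · exact hac
        · exact harcs e he

theorem exists_leaving_arc (S : Set V) (p : List V) :
    ∀ {a b : V}, p.head? = some a → p.getLast? = some b → a ∈ S → b ∉ S →
      ∃ e ∈ arcsOf p, e.1 ∈ S ∧ e.2 ∉ S := by
  induction p with
  | nil => intro a b h; simp at h
  | cons d p ih =>
    intro a b hhead hlast ha hb
    simp only [List.head?_cons, Option.some.injEq] at hhead
    subst hhead
    cases p with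
    | nil =>
      simp only [List.getLast?_singleton, Option.some.injEq] at hlast
      subst hlast
      exact absurd ha hb
    | cons c p =>
      by_cases hc : c ∈ S
      · obtain ⟨e, he, h⟩ := ih rfl (by simpa using hlast) hc hb
        exact ⟨e, by
          simp only [arcsOf, List.tail_cons, List.zip_cons_cons, List.mem_cons] at he ⊢
          exact Or.inr he, h⟩
      · exact ⟨(d, c), by simp [arcsOf], ha, hc⟩

theorem exists_previous (Q : Finset ℕ) {h : ℕ} (hh : 0 < h) :
    ∃ q ∈ insert 0 Q, q < h ∧ ∀ r ∈ Q, r < h → r ≤ q := by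
  have hne : ((insert 0 Q).filter fun r => r < h).Nonempty := ⟨0, by simp [hh]⟩
  have hmem := Finset.max'_mem _ hne
  rw [Finset.mem_filter] at hmem
  exact ⟨_, hmem.1, hmem.2, fun r hr hrh => Finset.le_max' _ _ (by simp [hr, hrh])⟩

/-- The augmentation `A` is good for the cut `Z`. -/
def Good (E A : Finset (V × V)) (s t : V) (Z : Finset (V × V)) : Prop :=
  Compatible E s Z A ∧ IsMinCutAug E A s t (coreAug E A Z t) ∧ WitnessingFlow E A Z s t

namespace WalkFlow

variable {E A : Finset (V × V)} {s t : V} {lam : ℕ}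

/-- A flow stays a flow when undeletable arcs are added. -/
def extend (W : WalkFlow E A s t lam) {A' : Finset (V × V)} (h : A ⊆ A') :
    WalkFlow E A' s t lam where
  len := W.len
  vert := W.vert
  vert_zero := W.vert_zero
  vert_of_le := W.vert_of_le
  arc_mem i m hm := (W.arc_mem i m hm).imp_right fun h' => h h'
  disj i j m hm n hn h1 h2 hA := W.disj i j m hm n hn h1 h2 fun h' => hA (h h')

theorem RR.extend {W : WalkFlow E A s t lam} {x y : V} (hxy : W.RR x y) {A' : Finset (V × V)}
    (h : A ⊆ A') : (W.extend h).RR x y := by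
  refine Relation.ReflTransGen.mono (fun a b hab => ?_) x y hxy
  exact hab.imp_left fun h' => h'.imp_left fun h'' => h h''

theorem rr_of_mem (W : WalkFlow E A s t lam) {x y : V} (h : (x, y) ∈ A) : W.RR x y :=
  Relation.ReflTransGen.single (Or.inl (Or.inl h))

/-- The first position on walk `j` that is not residually reachable from the `s`-side of `Z`. -/
noncomputable def deadPos (W : WalkFlow E A s t lam) (Z : Finset (V × V)) (j : Fin lam) : ℕ :=
  sInf {m | ¬ W.Alive Z (W.vert j m)}

section deadPos

variable (W : WalkFlow E A s t lam) {Z : Finset (V × V)} (j : Fin lam)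

theorem not_alive_deadPos (ht : ¬ W.Alive Z t) : ¬ W.Alive Z (W.vert j (W.deadPos Z j)) := by
  have : W.len j ∈ {m | ¬ W.Alive Z (W.vert j m)} := by
    change ¬ W.Alive Z (W.vert j (W.len j))
    rwa [W.vert_of_le j _ le_rfl]
  exact Nat.sInf_mem (s := {m | ¬ W.Alive Z (W.vert j m)}) ⟨_, this⟩

theorem deadPos_le (ht : ¬ W.Alive Z t) : W.deadPos Z j ≤ W.len j := by
  refine Nat.sInf_le ?_
  change ¬ W.Alive Z (W.vert j (W.len j))
  rwa [W.vert_of_le j _ le_rfl]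

theorem alive_of_lt_deadPos {m : ℕ} (hm : m < W.deadPos Z j) : W.Alive Z (W.vert j m) := by
  by_contra hcon
  exact absurd (Nat.sInf_le hcon) (not_le.2 hm)

theorem not_alive_of_deadPos_le (ht : ¬ W.Alive Z t) {m : ℕ} (hm : W.deadPos Z j ≤ m) :
    ¬ W.Alive Z (W.vert j m) := fun h =>
  W.not_alive_deadPos j ht (h.of_rr (W.rr_vert j hm))

theorem one_le_deadPos (ht : ¬ W.Alive Z t) : 1 ≤ W.deadPos Z j := by
  by_contra hcon
  refine W.not_alive_of_deadPos_le j ht (m := 0) (by omega) ?_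
  rw [W.vert_zero]
  exact W.alive_of_mem (source_mem_sSide E s Z)

theorem deadPos_le_first (ht : ¬ W.Alive Z t) :
    W.deadPos Z j ≤ W.first j (W.vert j (W.deadPos Z j)) := by
  by_contra hcon
  refine W.not_alive_deadPos j ht ?_
  exact (W.alive_of_lt_deadPos j (not_le.1 hcon)).of_rr (W.rr_first j (W.rr_sink_vert j _))

end deadPos

theorem le_card_of_isCutAug (W : WalkFlow E A s t lam) {Z' : Finset (V × V)}
    (h : IsCutAug E A s t Z') : lam ≤ Z'.card := by
  have hex : ∀ j, ∃ m < W.len j, (W.vert j m, W.vert j (m + 1)) ∈ Z' ∧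
      (W.vert j m, W.vert j (m + 1)) ∉ A := by
    intro j
    by_contra hcon
    push Not at hcon
    refine h.2 ?_
    have key : ∀ m ≤ W.len j, Reach (((E : Set (V × V)) \ Z') ∪ A) s (W.vert j m) := by
      intro m
      induction m with
      | zero => intro _; rw [W.vert_zero]; exact Relation.ReflTransGen.refl
      | succ m ih =>
        intro hm
        refine Relation.ReflTransGen.tail (ih (by omega)) ?_
        by_cases hA : (W.vert j m, W.vert j (m + 1)) ∈ A
        · exact Or.inr hA
        · exact Or.inl ⟨(W.arc_mem j m (by omega)).resolve_right hA,
            fun hZ => hA (hcon m (by omega) hZ)⟩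
    have := key (W.len j) le_rfl
    rwa [W.vert_of_le j _ le_rfl] at this
  choose m hm hZ hA using hex
  have := Finset.card_le_card_of_injOn (s := (Finset.univ : Finset (Fin lam))) (t := Z')
    (fun j => (W.vert j (m j), W.vert j (m j + 1))) (fun j _ => hZ j) (by
      intro i _ j _ hij
      simp only [Prod.mk.injEq] at hij
      exact (W.disj i j _ (hm i) _ (hm j) hij.1 hij.2 (hA i)).1)
  simpa using this

/-- A criterion for the augmentation `A'` to be good for `Z`. -/
theorem good_of_reach (W : WalkFlow E A s t lam) {Z A' : Finset (V × V)}
    (hZ : IsStarCut E s t Z) (hcomp : Compatible E s Z A) (hAA : A ⊆ A')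
    (ht : ¬ W.Alive Z t) (hx : ∀ j, W.vert j (W.deadPos Z j - 1) ∈ sSide E s Z)
    (hnew : ∀ e ∈ A', e ∈ A ∨ e.2 ∈ sSide E s Z ∨ ∃ j m, W.deadPos Z j ≤ m ∧ e.1 = W.vert j m)
    (hreach : ∀ j, Relation.ReflTransGen (fun x y => x ∈ sSide E s Z ∧ y ∈ sSide E s Z ∧
      ((x, y) ∈ A' ∨ ∃ m < W.len j, W.vert j m = x ∧ W.vert j (m + 1) = y))
      s (W.vert j (W.deadPos Z j - 1))) :
    Good E A' s t Z := by
  set S := sSide E s Z with hS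
  have hdeadS : ∀ {v}, ¬ W.Alive Z v → v ∉ S := fun h h' => h (W.alive_of_mem h')
  have hcomp' : Compatible E s Z A' := by
    intro e he he1
    rcases hnew e he with h | h | ⟨j, m, hm, h⟩
    · exact hcomp e h he1
    · exact h
    · rw [h] at he1
      exact absurd he1 (hdeadS (W.not_alive_of_deadPos_le j ht hm))
  have hw1 : ∀ j, W.deadPos Z j - 1 + 1 = W.deadPos Z j := fun j =>
    Nat.sub_add_cancel (W.one_le_deadPos j ht)
  set c : Fin lam → V × V := fun j => (W.vert j (W.deadPos Z j - 1), W.vert j (W.deadPos Z j))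
    with hc
  have hcZ : ∀ j, W.deadPos Z j - 1 < W.len j ∧ c j ∈ Z ∧ c j ∉ A := by
    intro j
    have := W.arc_mem_of_leaves hZ hcomp (i := j) (hx j)
      (by rw [hw1]; exact hdeadS (W.not_alive_deadPos j ht))
    rwa [hw1] at this
  have hcA' : ∀ j, c j ∉ A' := fun j h =>
    hdeadS (W.not_alive_deadPos j ht) (hcomp' _ h (hx j))
  have hcinj : Function.Injective c := by
    intro i j hij
    simp only [hc, Prod.mk.injEq] at hij
    refine (W.disj i j _ (hcZ i).1 _ (hcZ j).1 hij.1 ?_ ?_).1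
    · rw [hw1, hw1]; exact hij.2
    · rw [hw1]; exact (hcZ i).2.2
  set M : Set V := {v | ¬ W.RR v t ∧ ∀ j, ¬ W.RR v (W.vert j (W.deadPos Z j))} with hM
  have hSM : ∀ {v}, v ∈ S → v ∈ M := fun {v} hv =>
    ⟨fun h => ht ⟨v, hv, h⟩, fun j h => W.not_alive_deadPos j ht ⟨v, hv, h⟩⟩
  have hMrr : ∀ {x y}, x ∈ M → W.RR x y → y ∈ M := fun hx hxy =>
    ⟨fun h => hx.1 (hxy.trans h), fun j h => hx.2 j (hxy.trans h)⟩
  have hleave : ∀ x y, ((x, y) ∈ E ∨ (x, y) ∈ A') → x ∈ M → y ∉ M → ∃ j, (x, y) = c j := by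
    intro x y hxy hxM hyM
    rcases hxy with hE | hA'
    · by_cases hu : W.Uses x y
      · obtain ⟨i, m, hm, rfl, rfl⟩ := hu
        have hlt : m < W.deadPos Z i := by
          by_contra hcon
          exact hxM.2 i (W.rr_vert i (not_lt.1 hcon))
        have heq : m + 1 = W.deadPos Z i := by
          by_contra hne
          have hal := W.alive_of_lt_deadPos i (m := m + 1) (Z := Z) (by omega)
          exact hyM ⟨fun h => ht (hal.of_rr h), fun j h =>
            W.not_alive_deadPos j ht (hal.of_rr h)⟩
        refine ⟨i, ?_⟩
        simp only [hc, ← heq, Nat.add_sub_cancel]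
      · exact absurd (hMrr hxM (Relation.ReflTransGen.single (Or.inl (Or.inr ⟨hE, hu⟩)))) hyM
    · rcases hnew _ hA' with h | h | ⟨j, m, hm, h⟩
      · exact absurd (hMrr hxM (W.rr_of_mem h)) hyM
      · exact absurd (hSM h) hyM
      · simp only at h
        rw [h] at hxM
        exact absurd (W.rr_vert j hm) (hxM.2 j)
  have hclosed : ∀ {C : Finset (V × V)}, (∀ j, c j ∈ C) → ∀ {v u}, v ∈ M →
      Reach (((E : Set (V × V)) \ C) ∪ A') v u → u ∈ M := by
    intro C hC v u hv hvu
    induction hvu with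
    | refl => exact hv
    | tail _ hab ih =>
      by_contra hcon
      obtain ⟨j, hj⟩ := hleave _ _ (hab.imp (fun h => h.1) id) ih hcon
      rcases hab with h | h
      · exact h.2 (by rw [hj]; exact hC j)
      · exact hcA' j (by rw [← hj]; exact h)
  have htM : t ∉ M := fun h => h.1 (W.rr_refl t)
  have hsuffix : ∀ j, Relation.ReflTransGen (fun x y => x ∉ S ∧ y ∉ S ∧
      ∃ m < W.len j, W.vert j m = x ∧ W.vert j (m + 1) = y) (W.vert j (W.deadPos Z j)) t := by
    intro j
    have key : ∀ m, W.deadPos Z j ≤ m → m ≤ W.len j → Relation.ReflTransGen (fun x y => x ∉ S ∧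
        y ∉ S ∧ ∃ m < W.len j, W.vert j m = x ∧ W.vert j (m + 1) = y)
        (W.vert j (W.deadPos Z j)) (W.vert j m) := by
      intro m hm
      induction m, hm using Nat.le_induction with
      | base => intro _; exact Relation.ReflTransGen.refl
      | succ m hm ih =>
        intro hlen
        exact (ih (by omega)).tail ⟨hdeadS (W.not_alive_of_deadPos_le j ht hm),
          hdeadS (W.not_alive_of_deadPos_le j ht (by omega)), m, by omega, rfl, rfl⟩
    have := key (W.len j) (W.deadPos_le j ht) le_rfl
    rwa [W.vert_of_le j _ le_rfl] at this
  have hcore : coreAug E A' Z t = Finset.univ.image c := by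
    ext e
    simp only [coreAug, Finset.mem_filter, Finset.mem_image, Finset.mem_univ, true_and]
    constructor
    · rintro ⟨heZ, hr⟩
      by_cases hM2 : e.2 ∈ M
      · exact absurd (hclosed (fun j => (hcZ j).2.1) hM2 hr) htM
      · obtain ⟨j, hj⟩ := hleave e.1 e.2 (Or.inl (hZ.1.1 heZ)) (hSM (hZ.2 e heZ).1) hM2
        exact ⟨j, hj.symm⟩
    · rintro ⟨j, rfl⟩
      refine ⟨(hcZ j).2.1, Relation.ReflTransGen.mono ?_ _ _ (hsuffix j)⟩
      rintro x y ⟨hxS, -, m, hm, rfl, rfl⟩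
      rcases W.arc_mem j m hm with h | h
      · exact Or.inl ⟨h, fun hz => hxS (hZ.2 _ hz).1⟩
      · exact Or.inr (hAA h)
  have hcard : (coreAug E A' Z t).card = lam := by
    rw [hcore, Finset.card_image_of_injective _ hcinj, Finset.card_univ, Fintype.card_fin]
  have hcmem : ∀ j, c j ∈ coreAug E A' Z t := fun j => by
    rw [hcore]; exact Finset.mem_image_of_mem c (Finset.mem_univ j)
  refine ⟨hcomp', ⟨⟨(Finset.filter_subset _ _).trans hZ.1.1, fun hr =>
    htM (hclosed hcmem (hSM (source_mem_sSide E s Z)) hr)⟩, fun Z' hZ' => ?_⟩, ?_⟩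
  · rw [hcard]
    exact (W.extend hAA).le_card_of_isCutAug hZ'
  · have hwalk : ∀ j, Relation.ReflTransGen (fun x y => ((x, y) ∈ A' ∨
        ∃ m < W.len j, W.vert j m = x ∧ W.vert j (m + 1) = y) ∧
        (x ∈ S → y ∉ S → (x, y) = c j)) s t := by
      intro j
      refine ((Relation.ReflTransGen.mono ?_ _ _ (hreach j)).tail
        (b := W.vert j (W.deadPos Z j - 1)) (c := W.vert j (W.deadPos Z j)) ?_).trans
        (Relation.ReflTransGen.mono ?_ _ _ (hsuffix j))
      · rintro x y ⟨-, hy, h⟩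
        exact ⟨h, fun _ h' => absurd hy h'⟩
      · exact ⟨Or.inr ⟨_, (hcZ j).1, rfl, by rw [hw1]⟩, fun _ _ => rfl⟩
      · rintro x y ⟨hx, -, h⟩
        exact ⟨Or.inr h, fun h' => absurd h' hx⟩
    choose p hchain hhead hlast harcs using fun j => exists_list_of_reflTransGen (hwalk j)
    have hpc : ∀ j, ∀ e ∈ arcsOf (p j), e ∈ Z → e = c j := fun j e he heZ =>
      (harcs j e he).2 (hZ.2 e heZ).1 (hZ.2 e heZ).2
    refine ⟨fun i => p (Fin.cast hcard i), ?_, ?_, ?_, ?_⟩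
    · intro i
      refine ⟨(hchain _).imp ?_, hhead _, hlast _⟩
      rintro x y ⟨h | ⟨m, hm, rfl, rfl⟩, -⟩
      · exact Or.inr h
      · exact (W.arc_mem _ m hm).imp id fun h => hAA h
    · intro i j hij e hei hej he
      obtain ⟨m, hm, h1, h2⟩ := (harcs _ e hei).1.resolve_left he.2
      obtain ⟨n, hn, h3, h4⟩ := (harcs _ e hej).1.resolve_left he.2
      have := (W.disj _ _ m hm n hn (h1.trans h3.symm) (h2.trans h4.symm)
        (by rw [h1, h2]; exact fun h => he.2 (hAA h))).1
      exact hij (Fin.cast_injective hcard this)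
    · intro i
      obtain ⟨e, he, he1, he2⟩ := exists_leaving_arc S _ (hhead (Fin.cast hcard i))
        (hlast (Fin.cast hcard i)) (source_mem_sSide E s Z) hZ.sink_notMem
      have hec : e = c (Fin.cast hcard i) := (harcs _ e he).2 he1 he2
      refine ⟨c (Fin.cast hcard i), ⟨hcmem _, hec ▸ he⟩, ?_⟩
      rintro e' ⟨h1, h2⟩
      exact hpc _ e' h2 (Finset.filter_subset _ _ h1)
    · intro i e he heZ
      rw [hpc _ e he heZ]
      exact hcmem _

/-- If for all cuts the heads of the last alive arcs lie on the boundary of the `s`-side, then a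
good augmentation can be sampled. -/
theorem exists_good [Fintype V] (W : WalkFlow E A s t lam) (k : ℕ)
    (T : Finset (Finset (V × V))) (μ : Finset (V × V) → ℝ) (hμ : ∀ Z, 0 ≤ μ Z)
    (hT : ∀ Z ∈ T, IsStarCut E s t Z ∧ Z.card ≤ k ∧ Compatible E s Z A)
    (ht : ∀ Z ∈ T, ¬ W.Alive Z t)
    (hx : ∀ Z ∈ T, ∀ j, W.vert j (W.deadPos Z j - 1) ∈ sSide E s Z) :
    ∃ A', (1 / 2 : ℝ) ^ ((8 * k + 2) * (2 * lam) * lam) * ∑ Z ∈ T, μ Z ≤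
      ∑ Z ∈ T with Good E A' s t Z, μ Z := by
  have hpos : ∀ J : Finset (Fin lam), ∃ Q : Fin lam → Finset ℕ,
      (∀ j, ∀ q ∈ Q j, 1 ≤ q ∧ q ≤ W.len j) ∧
      (1 / 2 : ℝ) ^ ((8 * k + 2) * (2 * lam) * J.card) * ∑ Z ∈ T, μ Z ≤
        ∑ Z ∈ T with ∀ j ∈ J, W.deadPos Z j ∈ Q j ∧ ∀ q ∈ Q j, q < W.deadPos Z j →
          W.vert j q ∈ sSide E s Z ∧ W.vert j (q - 1) ∈ sSide E s Z, μ Z := by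
    intro J
    induction J using Finset.induction_on with
    | empty => exact ⟨fun _ => ∅, by simp, by simp⟩
    | insert j J hj ih =>
      obtain ⟨Q, hQ, hQm⟩ := ih
      set T' := T.filter fun Z => ∀ j ∈ J, W.deadPos Z j ∈ Q j ∧ ∀ q ∈ Q j, q < W.deadPos Z j →
          W.vert j q ∈ sSide E s Z ∧ W.vert j (q - 1) ∈ sSide E s Z with hT'
      have hsub : ∀ Z ∈ T', Z ∈ T := fun Z hZ => (Finset.mem_filter.1 hZ).1
      obtain ⟨R, hR, hRm⟩ := W.exists_positions k
        (fun b h => if b then W.vert j h else W.vert j (h - 1))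
        (by
          rintro (_ | _) n
          · exact W.rr_vert j (by omega)
          · exact W.rr_vert_succ j n)
        (by rintro (_ | _) n <;> exact W.rr_sink_vert j _)
        j.pos T' μ hμ (fun Z => W.deadPos Z j) (W.len j) (fun Z hZ => hT Z (hsub Z hZ))
        (fun Z hZ => ⟨W.one_le_deadPos j (ht Z (hsub Z hZ)), W.deadPos_le j (ht Z (hsub Z hZ))⟩)
        (by
          rintro Z hZ (_ | _) g hg
          · exact W.not_alive_of_deadPos_le j (ht Z (hsub Z hZ)) (by omega)
          · exact W.not_alive_of_deadPos_le j (ht Z (hsub Z hZ)) (by omega))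
        (by
          rintro Z hZ (_ | _) h hh
          · exact W.alive_of_lt_deadPos j (by omega)
          · exact W.alive_of_lt_deadPos j hh)
        (fun Z hZ => ⟨j, true, fun h hh =>
          ((W.first_le (W.rr_refl _)).trans_lt hh).trans_le
            (W.deadPos_le_first j (ht Z (hsub Z hZ)))⟩)
      refine ⟨Function.update Q j R, ?_, ?_⟩
      · intro i q hq
        by_cases hij : i = j
        · subst hij
          rw [Function.update_self] at hq
          exact hR q hq
        · rw [Function.update_of_ne hij] at hq
          exact hQ i q hq
      · rw [Finset.card_insert_of_notMem hj, Nat.mul_succ, add_comm, pow_add, mul_assoc]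
        refine (mul_le_mul_of_nonneg_left hQm (by positivity)).trans (hRm.trans ?_)
        refine Finset.sum_le_sum_of_subset_of_nonneg ?_ fun Z _ _ => hμ Z
        intro Z hZ
        rw [Finset.mem_filter] at hZ ⊢
        refine ⟨hsub Z hZ.1, fun i hi => ?_⟩
        by_cases hij : i = j
        · subst hij
          rw [Function.update_self]
          exact ⟨hZ.2.1, fun q hq hqw => ⟨by simpa using hZ.2.2 q hq hqw true,
            by simpa using hZ.2.2 q hq hqw false⟩⟩
        · rw [Function.update_of_ne hij]
          exact (Finset.mem_filter.1 hZ.1).2 i ((Finset.mem_insert.1 hi).resolve_left hij)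
  obtain ⟨Q, hQ, hQm⟩ := hpos Finset.univ
  rw [Finset.card_univ, Fintype.card_fin] at hQm
  set A' : Finset (V × V) := Finset.univ.filter fun e => e ∈ A ∨ ∃ j, ∃ q ∈ insert 0 (Q j),
    ∃ h ∈ Q j, q < h ∧ (∀ r ∈ Q j, r < h → r ≤ q) ∧ e = (W.vert j q, W.vert j (h - 1)) with hA'
  refine ⟨A', hQm.trans (Finset.sum_le_sum_of_subset_of_nonneg ?_ fun Z _ _ => hμ Z)⟩
  intro Z hZ
  rw [Finset.mem_filter] at hZ ⊢
  obtain ⟨hZT, hZQ⟩ := hZ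
  obtain ⟨hstar, -, hcomp⟩ := hT Z hZT
  refine ⟨hZT, W.good_of_reach hstar hcomp (fun e he => by simp [hA', he]) (ht Z hZT) (hx Z hZT)
    ?_ ?_⟩
  · intro e he
    simp only [hA', Finset.mem_filter, Finset.mem_univ, true_and] at he
    rcases he with he | ⟨j, q, hq, h, hh, hqh, hcons, rfl⟩
    · exact Or.inl he
    · obtain ⟨hw, hsafe⟩ := hZQ j (Finset.mem_univ j)
      rcases lt_trichotomy h (W.deadPos Z j) with hlt | heq | hgt
      · exact Or.inr (Or.inl (hsafe h hh hlt).2)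
      · exact Or.inr (Or.inl (by rw [heq]; exact hx Z hZT j))
      · exact Or.inr (Or.inr ⟨j, q, hcons _ hw hgt, rfl⟩)
  · intro j
    obtain ⟨hw, hsafe⟩ := hZQ j (Finset.mem_univ j)
    have key : ∀ h, h ∈ Q j → h ≤ W.deadPos Z j →
        Relation.ReflTransGen (fun x y => x ∈ sSide E s Z ∧ y ∈ sSide E s Z ∧
          ((x, y) ∈ A' ∨ ∃ m < W.len j, W.vert j m = x ∧ W.vert j (m + 1) = y))
          s (W.vert j (h - 1)) := by
      intro h
      induction h using Nat.strong_induction_on with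
      | _ h ih =>
        intro hh hhw
        obtain ⟨q, hq, hqh, hcons⟩ := exists_previous (Q j) (hQ j h hh).1
        have hhead : W.vert j (h - 1) ∈ sSide E s Z := by
          rcases hhw.lt_or_eq with hlt | heq
          · exact (hsafe h hh hlt).2
          · rw [heq]; exact hx Z hZT j
        have harc : (W.vert j q, W.vert j (h - 1)) ∈ A' := by
          simp only [hA', Finset.mem_filter, Finset.mem_univ, true_and]
          exact Or.inr ⟨j, q, hq, h, hh, hqh, hcons, rfl⟩
        rcases Finset.mem_insert.1 hq with rfl | hqQ
        · rw [W.vert_zero] at harc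
          exact Relation.ReflTransGen.single ⟨source_mem_sSide E s Z, hhead, Or.inl harc⟩
        · have hq1 := hQ j q hqQ
          have hqS := hsafe q hqQ (by omega)
          refine ((ih q hqh hqQ (by omega)).tail (b := W.vert j (q - 1)) (c := W.vert j q)
            ⟨hqS.2, hqS.1, Or.inr ⟨q - 1, by omega, rfl, ?_⟩⟩).tail
            ⟨hqS.1, hhead, Or.inl harc⟩
          rw [Nat.sub_add_cancel hq1.1]
    exact key _ hw le_rfl

/-- If the last alive vertex of walk `j` is off the `s`-side but the first vertex of walk `i`
reaching it is on the `s`-side, then arcs enlarging the flow can be sampled. -/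
theorem exists_larger_flow [Fintype V] (W : WalkFlow E A s t lam) (k : ℕ) (i j : Fin lam)
    (T : Finset (Finset (V × V))) (μ : Finset (V × V) → ℝ) (hμ : ∀ Z, 0 ≤ μ Z)
    (hT : ∀ Z ∈ T, IsStarCut E s t Z ∧ Z.card ≤ k ∧ Compatible E s Z A)
    (ht : ∀ Z ∈ T, ¬ W.Alive Z t)
    (hx : ∀ Z ∈ T, W.vert j (W.deadPos Z j - 1) ∉ sSide E s Z)
    (hσ : ∀ Z ∈ T, W.vert i (W.first i (W.vert j (W.deadPos Z j - 1))) ∈ sSide E s Z) :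
    ∃ A', Nonempty (WalkFlow E A' s t (lam + 1)) ∧
      (1 / 2 : ℝ) ^ ((8 * k + 2) * (2 * lam)) * ∑ Z ∈ T, μ Z ≤
        ∑ Z ∈ T with Compatible E s Z A', μ Z := by
  set σ : ℕ → V := fun h => W.vert i (W.first i (W.vert j (h - 1))) with hσdef
  have hσmono : ∀ {m n}, m ≤ n → W.RR (σ n) (σ m) := fun {m n} hmn =>
    W.rr_vert i (W.first_mono i (W.rr_sink_vert j _) (W.rr_vert j (by omega)))
  have hσrr : ∀ h, W.RR (σ h) (W.vert j (h - 1)) := fun h =>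
    W.rr_first i (W.rr_sink_vert j _)
  obtain ⟨Q, hQ, hQm⟩ := W.exists_positions k (fun b h => if b then W.vert j h else σ h)
    (by
      rintro (_ | _) n
      · exact hσmono (Nat.le_succ n)
      · exact W.rr_vert_succ j n)
    (by rintro (_ | _) n <;> exact W.rr_sink_vert _ _)
    j.pos T μ hμ (fun Z => W.deadPos Z j) (W.len j) hT
    (fun Z hZ => ⟨W.one_le_deadPos j (ht Z hZ), W.deadPos_le j (ht Z hZ)⟩)
    (by
      rintro Z hZ (_ | _) g hg
      · exact fun h => W.not_alive_of_deadPos_le j (ht Z hZ) (m := g - 1) (by omega)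
          (h.of_rr (hσrr g))
      · exact W.not_alive_of_deadPos_le j (ht Z hZ) (by omega))
    (by
      rintro Z hZ (_ | _) h hh
      · exact ⟨_, hσ Z hZ, hσmono hh.le⟩
      · exact W.alive_of_lt_deadPos j hh)
    (fun Z hZ => ⟨j, true, fun h hh =>
      ((W.first_le (W.rr_refl _)).trans_lt hh).trans_le (W.deadPos_le_first j (ht Z hZ))⟩)
  set A' : Finset (V × V) := Finset.univ.filter fun e => e ∈ A ∨
    (∃ q ∈ insert 0 Q, ∃ h ∈ Q, q < h ∧ (∀ r ∈ Q, r < h → r ≤ q) ∧ e = (W.vert j q, σ h)) ∨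
    (∃ h ∈ Q, e = (W.vert j (h - 1), W.vert j h)) ∨ e = (W.vert j (Q.sup id), t) with hA'
  have hAA : A ⊆ A' := fun e he => by simp [hA', he]
  refine ⟨A', ?_, ?_⟩
  · refine (W.extend hAA).exists_augment ?_
    change (W.extend hAA).RR s t
    have key : ∀ h, h ∈ insert 0 Q → (W.extend hAA).RR s (W.vert j h) := by
      intro h
      induction h using Nat.strong_induction_on with
      | _ h ih =>
        intro hh
        rcases Finset.mem_insert.1 hh with rfl | hhQ
        · rw [W.vert_zero]; exact rr_refl _ s
        · obtain ⟨q, hq, hqh, hcons⟩ := exists_previous Q (hQ h hhQ).1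
          have h1 : (W.vert j q, σ h) ∈ A' := by
            simp only [hA', Finset.mem_filter, Finset.mem_univ, true_and]
            exact Or.inr (Or.inl ⟨q, hq, h, hhQ, hqh, hcons, rfl⟩)
          have h2 : (W.vert j (h - 1), W.vert j h) ∈ A' := by
            simp only [hA', Finset.mem_filter, Finset.mem_univ, true_and]
            exact Or.inr (Or.inr (Or.inl ⟨h, hhQ, rfl⟩))
          exact (((ih q hqh hq).trans (rr_of_mem _ h1)).trans ((hσrr h).extend hAA)).trans
            (rr_of_mem _ h2)
    refine (key (Q.sup id) ?_).trans (rr_of_mem _ ?_)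
    · rcases Q.eq_empty_or_nonempty with rfl | hne
      · simp
      · obtain ⟨q, hq, hqs⟩ := Finset.exists_mem_eq_sup Q hne id
        rw [hqs]
        exact Finset.mem_insert_of_mem hq
    · simp [hA']
  · refine hQm.trans (Finset.sum_le_sum_of_subset_of_nonneg ?_ fun Z _ _ => hμ Z)
    intro Z hZ
    rw [Finset.mem_filter] at hZ ⊢
    obtain ⟨hZT, hw, hsafe⟩ := hZ
    refine ⟨hZT, fun e he he1 => ?_⟩
    have hdead : ∀ {m}, W.deadPos Z j ≤ m → W.vert j m ∉ sSide E s Z := fun hm h =>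
      W.not_alive_of_deadPos_le j (ht Z hZT) hm (W.alive_of_mem h)
    simp only [hA', Finset.mem_filter, Finset.mem_univ, true_and] at he
    rcases he with he | ⟨q, hq, h, hh, hqh, hcons, rfl⟩ | ⟨h, hh, rfl⟩ | rfl
    · exact (hT Z hZT).2.2 e he he1
    · rcases lt_trichotomy h (W.deadPos Z j) with hlt | heq | hgt
      · simpa using hsafe h hh hlt false
      · simp only [heq, hσdef]; exact hσ Z hZT
      · exact absurd he1 (hdead (hcons _ hw hgt))
    · rcases lt_trichotomy h (W.deadPos Z j) with hlt | heq | hgt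
      · simpa using hsafe h hh hlt true
      · rw [heq] at he1
        exact absurd he1 (hx Z hZT)
      · exact absurd he1 (hdead (by omega))
    · exact absurd he1 (hdead (Finset.le_sup (f := id) hw))

/-- The number of random bits used in one round. -/
def roundBits (k : ℕ) : ℕ := 2 * k + (8 * k + 2) * (2 * k) * k

theorem one_add_le_four_pow (n : ℕ) : 1 + n + n * n ≤ 4 ^ n := by
  induction n with
  | zero => simp
  | succ n ih => rw [pow_succ]; nlinarith

/-- One round: either a good augmentation is found, or the flow is enlarged. -/
theorem exists_round [Fintype V] (W : WalkFlow E A s t lam) (k : ℕ) (hlk : lam ≤ k)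
    (T : Finset (Finset (V × V))) (μ : Finset (V × V) → ℝ) (hμ : ∀ Z, 0 ≤ μ Z)
    (hT : ∀ Z ∈ T, IsStarCut E s t Z ∧ Z.card ≤ k ∧ Compatible E s Z A) :
    ∃ A', (1 / 2 : ℝ) ^ roundBits k * ∑ Z ∈ T, μ Z ≤ ∑ Z ∈ T with Good E A' s t Z, μ Z ∨
      (Nonempty (WalkFlow E A' s t (lam + 1)) ∧
        (1 / 2 : ℝ) ^ roundBits k * ∑ Z ∈ T, μ Z ≤ ∑ Z ∈ T with Compatible E s Z A', μ Z) := by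
  have hpow : ∀ {n : ℕ} {T' : Finset (Finset (V × V))} {x : ℝ}, n ≤ (8 * k + 2) * (2 * k) * k →
      (1 / 2 : ℝ) ^ (2 * k) * ∑ Z ∈ T, μ Z ≤ ∑ Z ∈ T', μ Z →
      (1 / 2 : ℝ) ^ n * ∑ Z ∈ T', μ Z ≤ x → (1 / 2 : ℝ) ^ roundBits k * ∑ Z ∈ T, μ Z ≤ x := by
    intro n T' x hn h1 h2
    refine le_trans ?_ h2
    rw [roundBits, add_comm, pow_add, mul_assoc]
    refine mul_le_mul (pow_le_pow_of_le_one (by norm_num) (by norm_num) hn) h1 ?_ (by positivity)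
    exact mul_nonneg (by positivity) (Finset.sum_nonneg fun Z _ => hμ Z)
  have hsum0 : 0 ≤ ∑ Z ∈ T, μ Z := Finset.sum_nonneg fun Z _ => hμ Z
  by_cases hst : W.RR s t
  · refine ⟨A, Or.inr ⟨W.exists_augment hst, ?_⟩⟩
    rw [Finset.filter_true_of_mem fun Z hZ => (hT Z hZ).2.2]
    exact mul_le_of_le_one_left hsum0 (pow_le_one₀ (by norm_num) (by norm_num))
  set P : Unit ⊕ Fin lam ⊕ (Fin lam × Fin lam) → Finset (V × V) → Prop := fun c Z =>
    match c with
    | .inl _ => ¬ W.Alive Z t ∧ ∀ j, W.vert j (W.deadPos Z j - 1) ∈ sSide E s Z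
    | .inr (.inl i) => W.vert i (W.first i t) ∈ sSide E s Z
    | .inr (.inr (i, j)) => ¬ W.Alive Z t ∧ W.vert j (W.deadPos Z j - 1) ∉ sSide E s Z ∧
        W.vert i (W.first i (W.vert j (W.deadPos Z j - 1))) ∈ sSide E s Z with hP
  have hcover : ∀ Z ∈ T, ∃ c, P c Z := by
    intro Z hZ
    by_cases ht : W.Alive Z t
    · obtain ⟨i, hi⟩ := W.exists_first_mem ht (Or.inl hst)
      exact ⟨.inr (.inl i), hi⟩
    · by_cases hall : ∀ j, W.vert j (W.deadPos Z j - 1) ∈ sSide E s Z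
      · exact ⟨.inl (), ht, hall⟩
      · push Not at hall
        obtain ⟨j, hj⟩ := hall
        have h1 := W.one_le_deadPos j ht
        obtain ⟨i, hi⟩ := W.exists_first_mem
          (W.alive_of_lt_deadPos j (Z := Z) (m := W.deadPos Z j - 1) (by omega)) (Or.inr j.pos)
        exact ⟨.inr (.inr (i, j)), ht, hj, hi⟩
  obtain ⟨c, hc⟩ : ∃ c, (1 / 2 : ℝ) ^ (2 * k) * ∑ Z ∈ T, μ Z ≤ ∑ Z ∈ T with P c Z, μ Z := by
    by_contra hcon
    push Not at hcon
    have h1 : ∑ Z ∈ T, μ Z ≤ ∑ c, ∑ Z ∈ T with P c Z, μ Z := by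
      simp only [Finset.sum_filter]
      rw [Finset.sum_comm]
      refine Finset.sum_le_sum fun Z hZ => ?_
      obtain ⟨c, hc⟩ := hcover Z hZ
      refine le_trans (le_of_eq (if_pos hc).symm)
        (Finset.single_le_sum (f := fun c => if P c Z then μ Z else 0) (fun c _ => ?_)
          (Finset.mem_univ c))
      split_ifs
      · exact hμ Z
      · exact le_rfl
    have h2 : ∑ c, ∑ Z ∈ T with P c Z, μ Z <
        ∑ _c : Unit ⊕ Fin lam ⊕ (Fin lam × Fin lam), (1 / 2 : ℝ) ^ (2 * k) * ∑ Z ∈ T, μ Z :=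
      Finset.sum_lt_sum_of_nonempty Finset.univ_nonempty fun c _ => hcon c
    rw [Finset.sum_const, Finset.card_univ, nsmul_eq_mul, ← mul_assoc] at h2
    have h3 : (Fintype.card (Unit ⊕ Fin lam ⊕ (Fin lam × Fin lam)) : ℝ) * (1 / 2) ^ (2 * k) ≤ 1 := by
      have h4 : Fintype.card (Unit ⊕ Fin lam ⊕ (Fin lam × Fin lam)) ≤ 4 ^ k := by
        refine le_trans ?_ (Nat.pow_le_pow_right (by norm_num) hlk)
        refine le_trans (le_of_eq ?_) (one_add_le_four_pow lam)
        simp [add_assoc]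
      have h5 : (Fintype.card (Unit ⊕ Fin lam ⊕ (Fin lam × Fin lam)) : ℝ) ≤ 4 ^ k := by
        exact_mod_cast h4
      calc _ ≤ (4 : ℝ) ^ k * (1 / 2) ^ (2 * k) := by gcongr
        _ = 1 := by rw [pow_mul, ← mul_pow]; norm_num
    have h6 := mul_le_of_le_one_left hsum0 h3
    linarith
  have hTP : ∀ Z ∈ T.filter (P c), IsStarCut E s t Z ∧ Z.card ≤ k ∧ Compatible E s Z A :=
    fun Z hZ => hT Z (Finset.mem_filter.1 hZ).1
  have hPc : ∀ Z ∈ T.filter (P c), P c Z := fun Z hZ => (Finset.mem_filter.1 hZ).2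
  have hmono : ∀ p : Finset (V × V) → Prop,
      ∑ Z ∈ (T.filter (P c)) with p Z, μ Z ≤ ∑ Z ∈ T with p Z, μ Z := fun p =>
    Finset.sum_le_sum_of_subset_of_nonneg
      (Finset.filter_subset_filter _ (Finset.filter_subset _ _)) fun Z _ _ => hμ Z
  rcases c with _ | i | ⟨i, j⟩
  · obtain ⟨A', hA'⟩ := W.exists_good k _ μ hμ hTP (fun Z hZ => (hPc Z hZ).1)
      (fun Z hZ => (hPc Z hZ).2)
    refine ⟨A', Or.inl (hpow ?_ hc (hA'.trans (hmono _)))⟩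
    gcongr
  · have hAA : A ⊆ insert (s, W.vert i (W.first i t)) A := Finset.subset_insert _ _
    refine ⟨insert (s, W.vert i (W.first i t)) A, Or.inr ⟨(W.extend hAA).exists_augment ?_, ?_⟩⟩
    · exact RR.trans (rr_of_mem (W.extend hAA) (Finset.mem_insert_self _ _))
        ((W.rr_first i (W.rr_refl t)).extend hAA)
    · refine hpow (n := 0) (Nat.zero_le _) hc ?_
      rw [pow_zero, one_mul]
      refine le_trans (le_of_eq ?_) (hmono _)
      rw [Finset.filter_true_of_mem (s := T.filter _)]
      intro Z hZ e he he1
      rcases Finset.mem_insert.1 he with rfl | he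
      · exact hPc Z hZ
      · exact (hTP Z hZ).2.2 e he he1
  · obtain ⟨A', hflow, hA'⟩ := W.exists_larger_flow k i j _ μ hμ hTP (fun Z hZ => (hPc Z hZ).1)
      (fun Z hZ => (hPc Z hZ).2.1) (fun Z hZ => (hPc Z hZ).2.2)
    refine ⟨A', Or.inr ⟨hflow, hpow ?_ hc (hA'.trans (hmono _))⟩⟩
    have hk : 1 ≤ k := le_trans j.pos hlk
    calc (8 * k + 2) * (2 * lam) ≤ (8 * k + 2) * (2 * k) := by gcongr
      _ ≤ (8 * k + 2) * (2 * k) * k := Nat.le_mul_of_pos_right _ hk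

theorem exists_good_of_le [Fintype V] (k d : ℕ) :
    ∀ (lam : ℕ) (A : Finset (V × V)) (_ : WalkFlow E A s t lam), lam + d = k + 1 →
      ∀ (T : Finset (Finset (V × V))) (μ : Finset (V × V) → ℝ), (∀ Z, 0 ≤ μ Z) →
      (∀ Z ∈ T, IsStarCut E s t Z ∧ Z.card ≤ k ∧ Compatible E s Z A) →
      ∃ A', (1 / 2 : ℝ) ^ (roundBits k * d) * ∑ Z ∈ T, μ Z ≤
        ∑ Z ∈ T with Good E A' s t Z, μ Z := by
  induction d with
  | zero =>
    intro lam A W hd T μ hμ hT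
    have : T = ∅ := by
      refine Finset.eq_empty_of_forall_notMem fun Z hZ => ?_
      obtain ⟨h1, h2, h3⟩ := hT Z hZ
      have := W.le_card h1 h3
      omega
    exact ⟨∅, by simp [this]⟩
  | succ d ih =>
    intro lam A W hd T μ hμ hT
    obtain ⟨A', h | ⟨⟨W'⟩, h⟩⟩ := W.exists_round k (by omega) T μ hμ hT
    · refine ⟨A', le_trans (mul_le_mul_of_nonneg_right ?_ (Finset.sum_nonneg fun Z _ => hμ Z)) h⟩
      exact pow_le_pow_of_le_one (by norm_num) (by norm_num) (Nat.le_mul_of_pos_right _ d.succ_pos)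
    · obtain ⟨A'', h'⟩ := ih (lam + 1) A' W' (by omega)
        (T.filter fun Z => Compatible E s Z A') μ hμ
        (fun Z hZ => by
          rw [Finset.mem_filter] at hZ
          exact ⟨(hT Z hZ.1).1, (hT Z hZ.1).2.1, hZ.2⟩)
      refine ⟨A'', ?_⟩
      rw [Nat.mul_succ, pow_add, mul_assoc]
      refine (mul_le_mul_of_nonneg_left h (by positivity)).trans (h'.trans ?_)
      exact Finset.sum_le_sum_of_subset_of_nonneg
        (Finset.filter_subset_filter _ (Finset.filter_subset _ _)) fun Z _ _ => hμ Z

end WalkFlow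

/-- For every weighting of the star cuts there is an augmentation that is good for a large
fraction of them. -/
theorem exists_good_augmentation [Fintype V] (E : Finset (V × V)) {s t : V} (k : ℕ)
    (T : Finset (Finset (V × V))) (μ : Finset (V × V) → ℝ) (hμ : ∀ Z, 0 ≤ μ Z)
    (hT : ∀ Z ∈ T, IsStarCut E s t Z ∧ Z.card ≤ k) :
    ∃ A, (1 / 2 : ℝ) ^ (WalkFlow.roundBits k * (k + 1)) * ∑ Z ∈ T, μ Z ≤
      ∑ Z ∈ T with Good E A s t Z, μ Z :=
  WalkFlow.exists_good_of_le k (k + 1) 0 ∅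
    ⟨Fin.elim0, Fin.elim0, fun i => i.elim0, fun i => i.elim0, fun i => i.elim0,
      fun i => i.elim0⟩ (by omega) T μ hμ
    fun Z hZ => ⟨(hT Z hZ).1, (hT Z hZ).2, fun e he => by simp at he⟩

/-- A minimax principle: if for every nonnegative weighting of `T` some pure strategy `a` captures
a `p`-fraction of the weight, then some mixed strategy captures each element of `T` with probability
at least `p`. -/
theorem exists_mixed_strategy {α β : Type*} [Fintype α] [Fintype β] (g : α → β → Prop)
    (T : Finset β) (p : ℝ)
    (h : ∀ μ : β → ℝ, (∀ b, 0 ≤ μ b) → ∃ a, p * ∑ b ∈ T, μ b ≤ ∑ b ∈ T with g a b, μ b) :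
    ∃ D ∈ stdSimplex ℝ α, ∀ b ∈ T, p ≤ ∑ a, if g a b then D a else 0 := by
  let L : (α → ℝ) →ₗ[ℝ] (β → ℝ) :=
    { toFun := fun D b => ∑ a, if b ∈ T ∧ g a b then D a else 0
      map_add' := fun D D' => by
        ext b
        simp only [Pi.add_apply, ← Finset.sum_add_distrib]
        exact Finset.sum_congr rfl fun a _ => by split_ifs <;> simp
      map_smul' := fun c D => by
        ext b
        simp only [Pi.smul_apply, smul_eq_mul, Finset.mul_sum, RingHom.id_apply]
        exact Finset.sum_congr rfl fun a _ => by split_ifs <;> simp }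
  have hL : ∀ D b, L D b = ∑ a, if b ∈ T ∧ g a b then D a else 0 := fun _ _ => rfl
  set S : Set (β → ℝ) := {x | ∀ b ∈ T, p ≤ x b} with hS
  by_contra! hcon
  have hdisj : Disjoint (L '' stdSimplex ℝ α) S := by
    rw [Set.disjoint_left]
    rintro _ ⟨D, hD, rfl⟩ hx
    obtain ⟨b, hb, hlt⟩ := hcon D hD
    have := hx b hb
    simp only [hL, hb, true_and] at this
    linarith
  have hSconv : Convex ℝ S := by
    intro x hx y hy c d hc hd hcd b hb
    have h1 := mul_le_mul_of_nonneg_left (hx b hb) hc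
    have h2 := mul_le_mul_of_nonneg_left (hy b hb) hd
    have h3 : c * p + d * p = p := by rw [← add_mul, hcd, one_mul]
    simp only [Pi.add_apply, Pi.smul_apply, smul_eq_mul]
    linarith
  have hSclosed : IsClosed S := by
    simp only [hS, Set.ofPred_forall]
    exact isClosed_iInter fun b => isClosed_iInter fun _ =>
      isClosed_le continuous_const (continuous_apply b)
  obtain ⟨f, u, v, hu, huv, hv⟩ := geometric_hahn_banach_compact_closed
    ((convex_stdSimplex ℝ α).linear_image L)
    ((isCompact_stdSimplex ℝ α).image (LinearMap.continuous_of_finiteDimensional L))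
    hSconv hSclosed hdisj
  have hf : ∀ x : β → ℝ, f x = ∑ b, x b * f (Pi.single b 1) := by
    intro x
    conv_lhs => rw [pi_eq_sum_univ' x]
    simp [map_sum]
  have hpos : ∀ b, 0 ≤ f (Pi.single b 1) := by
    intro b
    by_contra! hneg
    let y : β → ℝ := fun _ => p
    obtain ⟨c, hc, hc'⟩ : ∃ c : ℝ, 0 ≤ c ∧ f y + c * f (Pi.single b 1) ≤ v := by
      refine ⟨max 0 ((v - f y) / f (Pi.single b 1)), le_max_left _ _, ?_⟩
      have := mul_le_mul_of_nonpos_right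
        (le_max_right 0 ((v - f y) / f (Pi.single b 1))) hneg.le
      rw [div_mul_cancel₀ _ hneg.ne] at this
      linarith
    have := hv (y + c • Pi.single b 1) (fun b' _ => by
      have : 0 ≤ c * (Pi.single b 1 : β → ℝ) b' := by
        refine mul_nonneg hc ?_
        rw [Pi.single_apply]; split_ifs <;> norm_num
      simpa [y] using this)
    rw [map_add, map_smul, smul_eq_mul] at this
    linarith
  obtain ⟨a, ha⟩ := h (fun b => f (Pi.single b 1)) hpos
  have h1 := hu _ ⟨Pi.single a 1, single_mem_stdSimplex ℝ a, rfl⟩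
  have h2 := hv (fun b => if b ∈ T then p else 0) (fun b hb => by simp [hb])
  have e1 : f (L (Pi.single a 1)) = ∑ b ∈ T with g a b, f (Pi.single b 1) := by
    rw [hf, Finset.sum_filter, ← Finset.sum_subset (Finset.subset_univ T)
      (fun b _ hb => by simp [hL, hb])]
    refine Finset.sum_congr rfl fun b hb => ?_
    have : L (Pi.single a 1) b = if g a b then 1 else 0 := by
      rw [hL, Finset.sum_eq_single a]
      · simp [hb]
      · intro a' _ ha'; simp [ha']
      · simp
    rw [this]; split_ifs <;> simp
  have e2 : f (fun b => if b ∈ T then p else 0) = p * ∑ b ∈ T, f (Pi.single b 1) := by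
    rw [hf, Finset.mul_sum, ← Finset.sum_subset (Finset.subset_univ T)
      (fun b _ hb => by simp [hb])]
    exact Finset.sum_congr rfl fun b hb => by simp [hb]
  rw [e1] at h1
  rw [e2] at h2
  linarith

theorem rpow_neg_log_le_half_pow_roundBits (k : ℕ) :
    (2 : ℝ) ^ (-(64 * ((k : ℝ) + 2) ^ 4 * Real.log ((k : ℝ) + 2))) ≤
      (1 / 2 : ℝ) ^ (WalkFlow.roundBits k * (k + 1)) := by
  rw [one_div, inv_pow, ← Real.rpow_natCast 2, ← Real.rpow_neg zero_le_two]
  refine Real.rpow_le_rpow_of_exponent_le one_le_two (neg_le_neg ?_)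
  have hk : (0 : ℝ) ≤ k := Nat.cast_nonneg k
  have hlog : (1 / 2 : ℝ) ≤ Real.log ((k : ℝ) + 2) := by
    have := Real.log_le_log zero_lt_two (show (2 : ℝ) ≤ (k : ℝ) + 2 by linarith)
    have := Real.log_two_gt_d9
    linarith
  have h1 : ((WalkFlow.roundBits k * (k + 1) : ℕ) : ℝ) ≤ 32 * ((k : ℝ) + 2) ^ 4 := by
    simp only [WalkFlow.roundBits]
    push_cast
    nlinarith [pow_nonneg hk 2, pow_nonneg hk 3, pow_nonneg hk 4]
  have h2 := mul_le_mul_of_nonneg_left hlog (show (0 : ℝ) ≤ 64 * ((k : ℝ) + 2) ^ 4 by positivity)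
  linarith

/-- Randomized flow-augmentation for star `st`-cuts with a witnessing flow
(Theorem `thm:dir-flow-augmentation`). -/
theorem flow_augmentation_randomized_star :
    ∃ C : ℝ, 0 < C ∧
      ∀ (V : Type) [Fintype V] [DecidableEq V] (E : Finset (V × V)) (s t : V),
        s ≠ t → ∀ k : ℕ,
          ∃ D : Finset (V × V) → ℝ,
            (∀ A, 0 ≤ D A) ∧ (∑ A : Finset (V × V), D A) = 1 ∧
            ∀ Z : Finset (V × V), IsStarCut E s t Z → Z.card ≤ k →
              (2 : ℝ) ^ (-(C * ((k : ℝ) + 2) ^ 4 * Real.log ((k : ℝ) + 2))) ≤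
                ∑ A : Finset (V × V),
                  (if Compatible E s Z A ∧ IsMinCutAug E A s t (coreAug E A Z t) ∧
                      WitnessingFlow E A Z s t
                   then D A else 0) := by
  refine ⟨64, by norm_num, fun V _ _ E s t _ k => ?_⟩
  obtain ⟨D, hD, hp⟩ := exists_mixed_strategy (fun A Z => Good E A s t Z)
    (Finset.univ.filter fun Z => IsStarCut E s t Z ∧ Z.card ≤ k)
    ((1 / 2 : ℝ) ^ (WalkFlow.roundBits k * (k + 1)))
    (fun μ hμ => exists_good_augmentation E k _ μ hμ fun Z hZ => (Finset.mem_filter.1 hZ).2)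
  refine ⟨D, hD.1, by convert hD.2, fun Z hZ hk => ?_⟩
  refine (rpow_neg_log_le_half_pow_roundBits k).trans ?_
  refine (hp Z (Finset.mem_filter.2 ⟨Finset.mem_univ _, hZ, hk⟩)).trans_eq ?_
  exact Finset.sum_congr (by congr) fun A _ => by unfold Good; congr

end FlowAug
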